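/- arXiv:2208.12749 — 3 statements merged into one kernel-verified Lean document; each statement's English description precedes it below -/
import Mathlib

section
/- Let m ≥ 2 be an integer. There exists a smooth plane sextic C over K whose automorphism group Aut(C) ⊂ PGL₃(K) contains an element of order exactly m if and only if m ∈ {2, 3, 4, 5, 6, 7, 8, 10, 12, 15, 21, 24, 25, 30}. -/
open MvPolynomial

/-- `GL₃(K)`: the group of invertible `3 × 3` matrices over `K`. -/
abbrev GL3 (K : Type*) [Field K] := (Matrix (Fin 3) (Fin 3) K)ˣ

/-- `PGL₃(K)`: the quotient of `GL₃(K)` by its center (the scalar matrices). -/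
abbrev PGL3 (K : Type*) [Field K] := GL3 K ⧸ Subgroup.center (GL3 K)

variable {K : Type*} [Field K]

/-- The substitution `F(X,Y,Z) ↦ F(A·(X,Y,Z)ᵗ)` for a `3 × 3` matrix `A`. -/
noncomputable def matAct (A : Matrix (Fin 3) (Fin 3) K) (F : MvPolynomial (Fin 3) K) :
    MvPolynomial (Fin 3) K :=
  aeval (fun i => ∑ j, C (A i j) * X j) F

lemma matAct_one (F : MvPolynomial (Fin 3) K) : matAct 1 F = F := by
  unfold matAct
  have h : (fun i => ∑ j, C ((1 : Matrix (Fin 3) (Fin 3) K) i j) * X j)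
      = (X : Fin 3 → MvPolynomial (Fin 3) K) := by
    funext i
    rw [Finset.sum_eq_single i]
    · simp
    · intro b _ hb
      simp [Matrix.one_apply, Ne.symm hb]
    · simp
  rw [h, aeval_X_left_apply]

lemma matAct_matAct (A B : Matrix (Fin 3) (Fin 3) K) (F : MvPolynomial (Fin 3) K) :
    matAct B (matAct A F) = matAct (A * B) F := by
  unfold matAct
  rw [← AlgHom.comp_apply, comp_aeval]
  have h : (fun i => (aeval fun i => ∑ j, C (B i j) * X j) (∑ j, C (A i j) * X j))
      = fun i => ∑ j : Fin 3, C ((A * B) i j) * (X j : MvPolynomial (Fin 3) K) := by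
    funext i
    simp only [map_sum, map_mul, aeval_C, aeval_X, algebraMap_eq, Finset.mul_sum]
    rw [Finset.sum_comm]
    refine Finset.sum_congr rfl fun k _ => ?_
    rw [Matrix.mul_apply, map_sum, Finset.sum_mul]
    refine Finset.sum_congr rfl fun j _ => ?_
    rw [map_mul, mul_assoc]
  rw [h]

lemma matAct_smul (A : Matrix (Fin 3) (Fin 3) K) (c : K) (F : MvPolynomial (Fin 3) K) :
    matAct A (c • F) = c • matAct A F :=
  map_smul (aeval fun i => ∑ j, C (A i j) * X j) c F

/-- The class of a matrix `A` in `PGL₃(K)` (junk value `1` if `A` is not invertible). -/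
noncomputable def pgl (A : Matrix (Fin 3) (Fin 3) K) : PGL3 K := by
  classical
  exact if h : IsUnit A then (QuotientGroup.mk h.unit : PGL3 K) else 1

/-- `F` defines a smooth plane sextic: `F` is homogeneous of degree `6`, and `F` together with
its partial derivatives have no common zero besides the origin. -/
def IsSmoothSextic (F : MvPolynomial (Fin 3) K) : Prop :=
  F.IsHomogeneous 6 ∧
    ∀ p : Fin 3 → K, eval p F = 0 → (∀ i, eval p (pderiv i F) = 0) → p = 0

/-- The automorphism group of the plane curve `F = 0`: the subgroup of `PGL₃(K)` consisting of
the classes of matrices `A ∈ GL₃(K)` with `F(A·(X,Y,Z)ᵗ) = λ·F(X,Y,Z)` for some `λ ∈ K×`. -/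
noncomputable def planeAut (F : MvPolynomial (Fin 3) K) : Subgroup (PGL3 K) where
  carrier := {g | ∃ A : GL3 K, (QuotientGroup.mk A : PGL3 K) = g ∧
    ∃ c : K, c ≠ 0 ∧ matAct (A : Matrix (Fin 3) (Fin 3) K) F = c • F}
  one_mem' := ⟨1, rfl, 1, one_ne_zero, by rw [Units.val_one, matAct_one, one_smul]⟩
  mul_mem' := by
    rintro g h ⟨A, rfl, c, hc, hA⟩ ⟨B, rfl, d, hd, hB⟩
    exact ⟨A * B, rfl, c * d, mul_ne_zero hc hd, by
      rw [Units.val_mul, ← matAct_matAct, hA, matAct_smul, hB, smul_smul]⟩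
  inv_mem' := by
    rintro g ⟨A, rfl, c, hc, hA⟩
    refine ⟨A⁻¹, rfl, c⁻¹, inv_ne_zero hc, ?_⟩
    rw [eq_inv_smul_iff₀ hc, ← matAct_smul, ← hA, matAct_matAct, ← Units.val_mul,
      mul_inv_cancel, Units.val_one, matAct_one]

section CoordinateChange

lemma pderiv_aeval (g : Fin 3 → MvPolynomial (Fin 3) K) (F : MvPolynomial (Fin 3) K)
    (i : Fin 3) : pderiv i (aeval g F) = ∑ j, pderiv i (g j) * aeval g (pderiv j F) := by
  induction F using MvPolynomial.induction_on with
  | C a => simp [algebraMap_eq]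
  | add p q hp hq => simp only [map_add, hp, hq, mul_add, Finset.sum_add_distrib]
  | mul_X p k hp =>
    rw [map_mul, aeval_X, pderiv_mul, hp, Finset.sum_mul]
    simp_rw [pderiv_mul, pderiv_X, map_add, map_mul, aeval_X, Pi.single_apply, apply_ite (aeval g),
      map_one, map_zero, mul_add, Finset.sum_add_distrib, mul_ite, mul_one, mul_zero,
      Finset.sum_ite_eq, Finset.mem_univ, if_true, mul_assoc]
    rw [mul_comm (pderiv i (g k))]

lemma pderiv_matAct (A : Matrix (Fin 3) (Fin 3) K) (F : MvPolynomial (Fin 3) K) (i : Fin 3) :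
    pderiv i (matAct A F) = ∑ j, C (A j i) * matAct A (pderiv j F) := by
  have hX (k : Fin 3) : pderiv i (∑ j, C (A k j) * X j : MvPolynomial (Fin 3) K) = C (A k i) := by
    simp [pderiv_X, Pi.single_apply]
  unfold matAct
  rw [pderiv_aeval]
  exact Finset.sum_congr rfl fun j _ => by rw [hX]

lemma eval_matAct (A : Matrix (Fin 3) (Fin 3) K) (F : MvPolynomial (Fin 3) K) (p : Fin 3 → K) :
    eval p (matAct A F) = eval (A.mulVec p) F := by
  unfold matAct
  induction F using MvPolynomial.induction_on with
  | C a => simp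
  | add p q hp hq => simp only [map_add, hp, hq]
  | mul_X q k hq =>
    rw [map_mul, map_mul, hq, map_mul]
    simp [Matrix.mulVec, dotProduct]

lemma IsSmoothSextic.comp_units {F : MvPolynomial (Fin 3) K} (hF : IsSmoothSextic F) (P : GL3 K) :
    IsSmoothSextic (matAct (P : Matrix (Fin 3) (Fin 3) K) F) := by
  refine ⟨?_, fun p hp hdp => ?_⟩
  · have h := hF.1.aeval (n := 1) (fun i => ∑ j, C ((P : Matrix (Fin 3) (Fin 3) K) i j) * X j)
      fun i => IsHomogeneous.sum _ _ _ fun j _ => isHomogeneous_C_mul_X _ _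
    simpa using! h
  · have hinv : (↑P⁻¹ : Matrix (Fin 3) (Fin 3) K) * P = 1 := P.inv_mul
    have hPp : (P : Matrix (Fin 3) (Fin 3) K).mulVec p = 0 := by
      refine hF.2 _ (by rwa [eval_matAct] at hp) fun k => ?_
      set v : Fin 3 → K :=
        fun j => eval ((P : Matrix (Fin 3) (Fin 3) K).mulVec p) (pderiv j F) with hv
      have h0 : Matrix.vecMul v (P : Matrix (Fin 3) (Fin 3) K) = 0 := by
        funext i
        have h := hdp i
        simp only [pderiv_matAct, map_sum, map_mul, eval_C, eval_matAct] at h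
        simpa [Matrix.vecMul, dotProduct, hv, mul_comm] using h
      have hv0 : v = 0 := by
        have h := congrArg (fun w => Matrix.vecMul w (↑P⁻¹ : Matrix (Fin 3) (Fin 3) K)) h0
        simpa [Matrix.vecMul_vecMul, Units.mul_inv] using! h
      exact congrFun hv0 k
    have h := congrArg (fun w => (↑P⁻¹ : Matrix (Fin 3) (Fin 3) K).mulVec w) hPp
    simpa [Matrix.mulVec_mulVec, Units.inv_mul] using! h

lemma coeff_matAct_diagonal (d : Fin 3 → K) (F : MvPolynomial (Fin 3) K) (e : Fin 3 →₀ ℕ) :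
    coeff e (matAct (Matrix.diagonal d) F) = (∏ i, d i ^ e i) * coeff e F := by
  have hX : (fun i => ∑ j, C (Matrix.diagonal d i j) * X j)
      = fun i => (C (d i) * X i : MvPolynomial (Fin 3) K) := by
    funext i
    rw [Finset.sum_eq_single i]
    · simp
    · intro b _ hb
      simp [Matrix.diagonal_apply_ne d hb.symm]
    · simp
  unfold matAct
  rw [hX]
  induction F using MvPolynomial.induction_on' with
  | monomial u a =>
    have h : aeval (fun i => (C (d i) * X i : MvPolynomial (Fin 3) K)) (monomial u a)
        = monomial u ((∏ i, d i ^ u i) * a) := by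
      rw [aeval_monomial, Finsupp.prod_fintype _ _ (by simp), monomial_eq,
        Finsupp.prod_fintype _ _ (by simp)]
      simp only [mul_pow, Finset.prod_mul_distrib, algebraMap_eq, map_mul, map_prod, map_pow]
      ring
    rw [h, coeff_monomial, coeff_monomial]
    split_ifs with huv
    · rw [huv]
    · simp
  | add p q hp hq => rw [map_add, coeff_add, hp, hq, coeff_add, mul_add]

end CoordinateChange

section Diagonalization

lemma exists_mul_eq_mul_diagonal [IsAlgClosed K] [CharZero K] {A : Matrix (Fin 3) (Fin 3) K}
    {m : ℕ} (hm : m ≠ 0) {s : K} (hs : s ≠ 0) (hA : A ^ m = Matrix.scalar (Fin 3) s) :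
    ∃ (P : GL3 K) (d : Fin 3 → K),
      A * (P : Matrix (Fin 3) (Fin 3) K) = (P : Matrix (Fin 3) (Fin 3) K) * Matrix.diagonal d := by
  set f : Module.End K (Fin 3 → K) := Matrix.toLin' A with hf
  have hss : f.IsSemisimple := by
    refine Module.End.isSemisimple_of_squarefree_aeval_eq_zero
      (Polynomial.separable_X_pow_sub_C s (Nat.cast_ne_zero.mpr hm) hs).squarefree ?_
    have hfm : f ^ m = algebraMap K (Module.End K (Fin 3 → K)) s := by
      rw [hf, ← Matrix.toLin'_pow, hA]
      ext i j
      simp [Pi.single_apply]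
    simp [hfm]
  have htop : ⊤ ≤ Submodule.span K {v | ∃ μ : K, f v = μ • v} := by
    rw [← hss.iSup_eigenspace_eq_top, iSup_le_iff]
    exact fun μ v hv => Submodule.subset_span ⟨μ, Module.End.mem_eigenspace_iff.mp hv⟩
  let b₀ := Module.Basis.ofSpan htop
  have : Finite ((linearIndepOn_empty K id).extend
      (Set.empty_subset {v | ∃ μ : K, f v = μ • v})) := Module.Finite.finite_basis b₀
  have := Fintype.ofFinite ((linearIndepOn_empty K id).extend
      (Set.empty_subset {v | ∃ μ : K, f v = μ • v}))
  let b : Module.Basis (Fin 3) K (Fin 3 → K) := b₀.reindex (Fintype.equivFinOfCardEq (by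
    rw [← Module.finrank_eq_card_basis b₀, Module.finrank_fin_fun]))
  have hb : ∀ i, ∃ μ : K, f (b i) = μ • b i := fun i =>
    Module.Basis.ofSpan_subset htop ⟨_, (Module.Basis.reindex_apply _ _ _).symm⟩
  choose d hd using hb
  have := (Pi.basisFun K (Fin 3)).invertibleToMatrix b
  refine ⟨unitOfInvertible ((Pi.basisFun K (Fin 3)).toMatrix b), d, ?_⟩
  ext i j
  have h := congrFun (hd j) i
  simp only [hf, Matrix.toLin'_apply, Matrix.mulVec, dotProduct, Pi.smul_apply, smul_eq_mul] at h
  simp only [val_unitOfInvertible, Matrix.mul_diagonal]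
  simp [Matrix.mul_apply, Module.Basis.toMatrix_apply, h, mul_comm]

end Diagonalization

section Monomials

lemma eval_single_eq_coeff {F : MvPolynomial (Fin 3) K} {n : ℕ} (hF : F.IsHomogeneous n)
    (i : Fin 3) : eval (Pi.single i 1) F = coeff (Finsupp.single i n) F := by
  classical
  rw [eval_eq', Finset.sum_eq_single (Finsupp.single i n)]
  · have h : ∏ k, (Pi.single i 1 : Fin 3 → K) k ^ (Finsupp.single i n k) = 1 :=
      Finset.prod_eq_one fun k _ => by
        by_cases hk : k = i
        · subst hk; simp
        · simp [Finsupp.single_eq_of_ne hk]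
    rw [h, mul_one]
  · intro e he hne
    have hdeg : e.degree = n := by
      by_contra h
      exact mem_support_iff.mp he (hF.coeff_eq_zero h)
    obtain ⟨k, hk, hek⟩ : ∃ k, k ≠ i ∧ e k ≠ 0 := by
      by_contra! h
      have hei : e = Finsupp.single i (e i) := by
        ext k
        by_cases hk : k = i
        · subst hk; simp
        · rw [h k hk, Finsupp.single_eq_of_ne hk]
      rw [hei, Finsupp.degree_single] at hdeg
      exact hne (hdeg ▸ hei)
    rw [Finset.prod_eq_zero (Finset.mem_univ k), mul_zero]
    rw [Pi.single_eq_of_ne hk, zero_pow hek]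
  · intro h
    rw [notMem_support_iff.mp h, zero_mul]

lemma IsSmoothSextic.exists_coeff_ne_zero {F : MvPolynomial (Fin 3) K} (hF : IsSmoothSextic F)
    (i : Fin 3) : ∃ j, coeff (Finsupp.single i 5 + Finsupp.single j 1) F ≠ 0 := by
  by_contra! h
  have h0 : (Pi.single i 1 : Fin 3 → K) = 0 := by
    refine hF.2 _ ?_ fun j => ?_
    · rw [eval_single_eq_coeff hF.1, ← h i, ← Finsupp.single_add]
    · rw [eval_single_eq_coeff hF.1.pderiv, coeff_pderiv, h j, zero_mul]
  simpa using! congrFun h0 i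

lemma exists_eval_eq_zero [IsAlgClosed K] {G : MvPolynomial (Fin 3) K} {n : ℕ}
    (hG : G.IsHomogeneous n) (hn : n ≠ 0) {b : Fin 3} (hb : coeff (Finsupp.single b n) G ≠ 0)
    (v : Fin 3 → K) : ∃ t, eval (Function.update v b t) G = 0 := by
  classical
  set q : Polynomial K :=
    aeval (Function.update (fun i => Polynomial.C (v i)) b Polynomial.X) G with hq
  have hq' : q = ∑ e ∈ G.support,
      Polynomial.C (coeff e G * ∏ i ∈ Finset.univ.erase b, v i ^ e i) * Polynomial.X ^ e b := by
    rw [hq, aeval_def, eval₂_eq']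
    refine Finset.sum_congr rfl fun e _ => ?_
    rw [← Finset.mul_prod_erase _ _ (Finset.mem_univ b), Function.update_self,
      Finset.prod_congr rfl fun i hi => by
        rw [Function.update_of_ne (Finset.ne_of_mem_erase hi)]]
    simp only [Polynomial.algebraMap_eq, map_mul, map_prod, map_pow]
    ring
  have hcoeff : q.coeff n = coeff (Finsupp.single b n) G := by
    rw [hq', Polynomial.finsetSum_coeff, Finset.sum_eq_single (Finsupp.single b n)]
    · rw [Polynomial.coeff_C_mul_X_pow, if_pos (by simp), Finset.prod_eq_one, mul_one]
      intro i hi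
      rw [Finsupp.single_eq_of_ne (Finset.ne_of_mem_erase hi), pow_zero]
    · intro e he hne
      rw [Polynomial.coeff_C_mul_X_pow, if_neg]
      intro hen
      have hdeg : e.degree = n := by
        by_contra h
        exact mem_support_iff.mp he (hG.coeff_eq_zero h)
      refine hne (Finsupp.ext fun k => ?_)
      rw [Finsupp.degree_eq_sum, ← Finset.add_sum_erase _ _ (Finset.mem_univ b), hen] at hdeg
      by_cases hk : k = b
      · subst hk; simp [hen]
      · rw [Finsupp.single_eq_of_ne hk]
        exact Finset.sum_eq_zero_iff.mp (by omega : ∑ x ∈ Finset.univ.erase b, e x = 0) k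
          (Finset.mem_erase.mpr ⟨hk, Finset.mem_univ k⟩)
    · intro h
      exact absurd (mem_support_iff.mpr hb) h
  have hdeg : q.degree ≠ 0 := by
    intro h
    have := Polynomial.coeff_eq_zero_of_degree_lt (p := q) (n := n)
      (by rw [h]; exact_mod_cast Nat.pos_of_ne_zero hn)
    exact hb (hcoeff ▸ this)
  obtain ⟨t, ht⟩ := IsAlgClosed.exists_root q hdeg
  refine ⟨t, ?_⟩
  have h : Polynomial.eval t q = eval (Function.update v b t) G := by
    rw [hq', Polynomial.eval_finsetSum, eval_eq']
    refine Finset.sum_congr rfl fun e _ => ?_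
    have hprod : ∏ i ∈ Finset.univ.erase b, Function.update v b t i ^ e i
        = ∏ i ∈ Finset.univ.erase b, v i ^ e i := Finset.prod_congr rfl fun i hi => by
      rw [Function.update_of_ne (Finset.ne_of_mem_erase hi)]
    rw [← Finset.mul_prod_erase _ _ (Finset.mem_univ b), Function.update_self, hprod]
    simp only [Polynomial.eval_mul, Polynomial.eval_C, Polynomial.eval_pow, Polynomial.eval_X]
    ring
  rw [← h]
  exact ht

/-- A smooth sextic is not divisible by a variable. -/
lemma IsSmoothSextic.exists_coeff_ne_zero_of_apply_eq_zero [IsAlgClosed K]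
    {F : MvPolynomial (Fin 3) K} (hF : IsSmoothSextic F) {a b c : Fin 3} (hab : a ≠ b)
    (hac : a ≠ c) (hbc : b ≠ c)
    (hcoeff : coeff (Finsupp.single b 5 + Finsupp.single a 1) F ≠ 0) :
    ∃ e : Fin 3 →₀ ℕ, e a = 0 ∧ coeff e F ≠ 0 := by
  by_contra! h
  obtain ⟨G, rfl⟩ : X a ∣ F := by
    rw [X_dvd_iff_modMonomial_eq_zero]
    ext e
    rw [coeff_zero]
    by_cases he : Finsupp.single a 1 ≤ e
    · exact coeff_modMonomial_of_le _ he
    · rw [coeff_modMonomial_of_not_le _ he]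
      refine h e ?_
      rw [Finsupp.single_le_iff] at he
      omega
  have hG : G.IsHomogeneous 5 := by
    intro e he
    have h6 := hF.1 (d := Finsupp.single a 1 + e) (by rwa [coeff_X_mul])
    rw [map_add, Finsupp.weight_single] at h6
    simp only [Pi.one_apply, smul_eq_mul, mul_one] at h6
    omega
  rw [add_comm, coeff_X_mul] at hcoeff
  obtain ⟨t, ht⟩ := exists_eval_eq_zero hG (by norm_num) hcoeff (Pi.single c 1)
  have ha : Function.update (Pi.single c 1 : Fin 3 → K) b t a = 0 := by
    rw [Function.update_of_ne hab, Pi.single_eq_of_ne hac]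
  have h0 := hF.2 (Function.update (Pi.single c 1) b t) (by simp [ht]) fun i => by
    simp [Derivation.leibniz, ht, ha]
  simpa [Function.update_of_ne hbc.symm] using congrFun h0 c

end Monomials

section DiagonalAutomorphism

/-- The self-maps of a three-element set, up to conjugation by permutations. -/
lemma exists_perm_normal_form (j : Fin 3 → Fin 3) : ∃ σ : Equiv.Perm (Fin 3),
    (j (σ 0) = σ 0 ∧ j (σ 1) = σ 1 ∧ j (σ 2) = σ 2) ∨
    (j (σ 0) = σ 0 ∧ j (σ 1) = σ 1 ∧ j (σ 2) = σ 0) ∨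
    (j (σ 0) = σ 0 ∧ j (σ 1) = σ 0 ∧ j (σ 2) = σ 0) ∨
    (j (σ 0) = σ 0 ∧ j (σ 1) = σ 0 ∧ j (σ 2) = σ 1) ∨
    (j (σ 0) = σ 0 ∧ j (σ 1) = σ 2 ∧ j (σ 2) = σ 1) ∨
    (j (σ 0) = σ 1 ∧ j (σ 1) = σ 2 ∧ j (σ 2) = σ 0) ∨
    (j (σ 0) = σ 1 ∧ j (σ 1) = σ 0 ∧ j (σ 2) = σ 0) := by
  revert j
  decide

lemma prod_pow_eq_of_coeff_ne_zero {F : MvPolynomial (Fin 3) K} {d : Fin 3 → K} {γ : K}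
    (hD : matAct (Matrix.diagonal d) F = γ • F) {e : Fin 3 →₀ ℕ} (he : coeff e F ≠ 0) :
    ∏ i, d i ^ e i = γ := by
  have h := congrArg (coeff e) hD
  rw [coeff_matAct_diagonal, coeff_smul, smul_eq_mul] at h
  exact mul_right_cancel₀ he h

/-- A diagonal automorphism of a smooth sextic has order dividing `21`, `24`, `25` or `30`. -/
lemma IsSmoothSextic.exists_pow_eq_pow [IsAlgClosed K] {F : MvPolynomial (Fin 3) K}
    (hF : IsSmoothSextic F) {d : Fin 3 → K} (hd : ∀ i, d i ≠ 0) {γ : K}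
    (hD : matAct (Matrix.diagonal d) F = γ • F) :
    ∃ N ∈ ({21, 24, 25, 30} : Finset ℕ), ∃ s, ∀ i, d i ^ N = s := by
  choose j hj using hF.exists_coeff_ne_zero
  have hrel (i : Fin 3) : d i ^ 5 * d (j i) = γ := by
    classical
    rw [← prod_pow_eq_of_coeff_ne_zero hD (hj i)]
    simp only [Finsupp.add_apply, pow_add, Finset.prod_mul_distrib, Finsupp.single_apply]
    simp
  obtain ⟨σ, hσ⟩ := exists_perm_normal_form j
  set a := σ 0 with ha
  set b := σ 1 with hb
  set c := σ 2 with hc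
  have hx := hd a
  obtain ⟨y, hy⟩ : ∃ y, d b = y * d a := ⟨d b / d a, by field_simp⟩
  obtain ⟨z, hz⟩ : ∃ z, d c = z * d a := ⟨d c / d a, by field_simp⟩
  obtain ⟨u, hu⟩ : ∃ u, γ = u * d a ^ 6 := ⟨γ / d a ^ 6, by field_simp⟩
  have hy0 : y ≠ 0 := by
    rintro rfl
    exact hd b (by simp [hy])
  have hz0 : z ≠ 0 := by
    rintro rfl
    exact hd c (by simp [hz])
  have cancel {s t : K} (h : s * d a ^ 6 = t * d a ^ 6) : s = t :=
    mul_right_cancel₀ (pow_ne_zero 6 hx) h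
  have key {N : ℕ} (hN : N ∈ ({21, 24, 25, 30} : Finset ℕ)) (hyN : y ^ N = 1) (hzN : z ^ N = 1) :
      ∃ N ∈ ({21, 24, 25, 30} : Finset ℕ), ∃ s, ∀ i, d i ^ N = s := by
    refine ⟨N, hN, d a ^ N, fun i => ?_⟩
    obtain ⟨k, rfl⟩ := σ.surjective i
    fin_cases k
    · rfl
    · change d b ^ N = _
      rw [hy, mul_pow, hyN, one_mul]
    · change d c ^ N = _
      rw [hz, mul_pow, hzN, one_mul]
  have h0 := hrel a
  have h1 := hrel b
  have h2 := hrel c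
  rcases hσ with ⟨ja, jb, jc⟩ | ⟨ja, jb, jc⟩ | ⟨ja, jb, jc⟩ | ⟨ja, jb, jc⟩ | ⟨ja, jb, jc⟩ |
    ⟨ja, jb, jc⟩ | ⟨ja, jb, jc⟩ <;> rw [ja, hu] at h0 <;> rw [jb, hu] at h1 <;>
    rw [jc, hu] at h2 <;> simp only [hy, hz] at h0 h1 h2
  · have hu1 : u = 1 := cancel (by linear_combination -h0)
    have hy6 : y ^ 6 = 1 := hu1 ▸ cancel (by linear_combination h1)
    have hz6 : z ^ 6 = 1 := hu1 ▸ cancel (by linear_combination h2)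
    exact key (N := 30) (by decide) (by rw [pow_mul y 6 5, hy6, one_pow])
      (by rw [pow_mul z 6 5, hz6, one_pow])
  · have hu1 : u = 1 := cancel (by linear_combination -h0)
    have hy6 : y ^ 6 = 1 := hu1 ▸ cancel (by linear_combination h1)
    have hz5 : z ^ 5 = 1 := hu1 ▸ cancel (by linear_combination h2)
    exact key (N := 30) (by decide) (by rw [pow_mul y 6 5, hy6, one_pow])
      (by rw [pow_mul z 5 6, hz5, one_pow])
  · have hu1 : u = 1 := cancel (by linear_combination -h0)
    have hy5 : y ^ 5 = 1 := hu1 ▸ cancel (by linear_combination h1)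
    have hz5 : z ^ 5 = 1 := hu1 ▸ cancel (by linear_combination h2)
    exact key (N := 25) (by decide) (by rw [pow_mul y 5 5, hy5, one_pow])
      (by rw [pow_mul z 5 5, hz5, one_pow])
  · have hu1 : u = 1 := cancel (by linear_combination -h0)
    have hy5 : y ^ 5 = 1 := hu1 ▸ cancel (by linear_combination h1)
    have hzy : z ^ 5 * y = 1 := hu1 ▸ cancel (by linear_combination h2)
    refine key (N := 25) (by decide) (by rw [pow_mul y 5 5, hy5, one_pow]) ?_
    calc z ^ 25 = z ^ 25 * y ^ 5 := by rw [hy5, mul_one]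
      _ = (z ^ 5 * y) ^ 5 := by ring
      _ = 1 := by rw [hzy, one_pow]
  · have hu1 : u = 1 := cancel (by linear_combination -h0)
    have hyz : y ^ 5 * z = 1 := hu1 ▸ cancel (by linear_combination h1)
    have hzy : z ^ 5 * y = 1 := hu1 ▸ cancel (by linear_combination h2)
    refine key (N := 24) (by decide) ?_ ?_
    · calc y ^ 24 = y ^ 24 * (z ^ 5 * y) := by rw [hzy, mul_one]
        _ = (y ^ 5 * z) ^ 5 := by ring
        _ = 1 := by rw [hyz, one_pow]
    · calc z ^ 24 = z ^ 24 * (y ^ 5 * z) := by rw [hyz, mul_one]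
        _ = (z ^ 5 * y) ^ 5 := by ring
        _ = 1 := by rw [hzy, one_pow]
  · have huy : u = y := cancel (by linear_combination -h0)
    have hyz : y ^ 5 * z = y := (cancel (by linear_combination h1)).trans huy
    have hzy : z ^ 5 = y := (cancel (by linear_combination h2)).trans huy
    have hz21 : z ^ 21 = 1 := by
      refine mul_right_cancel₀ (pow_ne_zero 5 hz0) ?_
      calc z ^ 21 * z ^ 5 = (z ^ 5) ^ 5 * z := by ring
        _ = 1 * z ^ 5 := by rw [hzy, hyz, one_mul]
    refine key (N := 21) (by decide) ?_ hz21
    rw [← hzy, ← pow_mul, mul_comm, pow_mul, hz21, one_pow]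
  · have huy : u = y := cancel (by linear_combination -h0)
    have hy5 : y ^ 5 = y := (cancel (by linear_combination h1)).trans huy
    have hzy : z ^ 5 = y := (cancel (by linear_combination h2)).trans huy
    have hab : a ≠ b := fun h => absurd (σ.injective h) (by decide)
    have hac : a ≠ c := fun h => absurd (σ.injective h) (by decide)
    have hbc : b ≠ c := fun h => absurd (σ.injective h) (by decide)
    obtain ⟨e, hea, he⟩ := hF.exists_coeff_ne_zero_of_apply_eq_zero hab hac hbc (jb ▸ hj b)
    have hprod := prod_pow_eq_of_coeff_ne_zero hD he
    have hdeg : e.degree = 6 := by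
      by_contra h
      exact he (hF.1.coeff_eq_zero h)
    rw [Finsupp.degree_eq_sum, ← Equiv.sum_comp σ, Fin.sum_univ_three, ← ha, ← hb, ← hc, hea,
      zero_add] at hdeg
    rw [← Equiv.prod_comp σ, Fin.prod_univ_three, ← ha, ← hb, ← hc, hea, pow_zero, one_mul, hu,
      huy, hy, hz, mul_pow, mul_pow] at hprod
    have hmon : y ^ e b * z ^ e c = y := by
      refine cancel ?_
      rw [← hprod, ← hdeg, pow_add]
      ring
    have hy4 : y ^ 4 = 1 := mul_right_cancel₀ hy0 (by rw [one_mul, ← pow_succ, hy5])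
    have hz20 : z ^ 20 = 1 := by rw [pow_mul z 5 4, hzy, hy4]
    have hz5 : z ^ 5 = 1 := by
      have h4 : z ^ (4 * e b + 6) = z ^ 5 := by
        rw [show 4 * e b + 6 = 5 * e b + e c by omega, pow_add, pow_mul, hzy, hmon]
      refine mul_right_cancel₀ (pow_ne_zero 5 hz0) ?_
      calc z ^ 5 * z ^ 5 = (z ^ 20) ^ e b * z ^ 20 * (z ^ 5 * z ^ 5) := by
            rw [hz20, one_pow, one_mul, one_mul]
        _ = (z ^ (4 * e b + 6)) ^ 5 := by ring
        _ = z ^ 20 * z ^ 5 := by rw [h4]; ring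
        _ = 1 * z ^ 5 := by rw [hz20]
    exact key (N := 25) (by decide) (by rw [← hzy, hz5, one_pow])
      (by rw [pow_mul z 5 5, hz5, one_pow])

end DiagonalAutomorphism

section Order

lemma pgl_mk_pow_eq_one_iff {A : GL3 K} {N : ℕ} :
    (QuotientGroup.mk A : PGL3 K) ^ N = 1 ↔
      ∃ s, (A : Matrix (Fin 3) (Fin 3) K) ^ N = Matrix.scalar (Fin 3) s := by
  rw [← QuotientGroup.mk_pow, QuotientGroup.eq_one_iff]
  refine Matrix.GeneralLinearGroup.mem_center_iff_val_mem_range_scalar.trans ?_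
  rw [Units.val_pow_eq_pow_val]
  exact exists_congr fun s => eq_comm

lemma exists_orderOf_dvd [IsAlgClosed K] [CharZero K] {F : MvPolynomial (Fin 3) K}
    (hF : IsSmoothSextic F) {g : PGL3 K} (hg : g ∈ planeAut F) (hg0 : orderOf g ≠ 0) :
    ∃ N ∈ ({21, 24, 25, 30} : Finset ℕ), orderOf g ∣ N := by
  obtain ⟨A, rfl, γ, -, hA⟩ := hg
  obtain ⟨s, hs⟩ := pgl_mk_pow_eq_one_iff.mp (pow_orderOf_eq_one (QuotientGroup.mk A : PGL3 K))
  have hs0 : s ≠ 0 := by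
    rintro rfl
    rw [map_zero, ← Units.val_pow_eq_pow_val] at hs
    exact (A ^ _).ne_zero hs
  obtain ⟨P, d, hPd⟩ := exists_mul_eq_mul_diagonal hg0 hs0 hs
  have hconj : (A : Matrix (Fin 3) (Fin 3) K) = P * Matrix.diagonal d *
      (↑P⁻¹ : Matrix (Fin 3) (Fin 3) K) := by
    rw [← hPd, mul_assoc, P.mul_inv, mul_one]
  have hdiag : IsUnit (Matrix.diagonal d) := by
    have h : Matrix.diagonal d = ((P⁻¹ * A * P : GL3 K) : Matrix (Fin 3) (Fin 3) K) := by
      rw [Units.val_mul, Units.val_mul, mul_assoc, hPd, ← mul_assoc, P.inv_mul, one_mul]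
    rw [h]
    exact Units.isUnit _
  have hd (i : Fin 3) : d i ≠ 0 := by
    rw [Matrix.isUnit_iff_isUnit_det, Matrix.det_diagonal, isUnit_iff_ne_zero] at hdiag
    exact Finset.prod_ne_zero_iff.mp hdiag i (Finset.mem_univ i)
  have hD : matAct (Matrix.diagonal d) (matAct (P : Matrix (Fin 3) (Fin 3) K) F)
      = γ • matAct (P : Matrix (Fin 3) (Fin 3) K) F := by
    rw [matAct_matAct, ← hPd, ← matAct_matAct, hA, matAct_smul]
  obtain ⟨N, hN, t, ht⟩ := (hF.comp_units P).exists_pow_eq_pow hd hD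
  refine ⟨N, hN, orderOf_dvd_of_pow_eq_one (pgl_mk_pow_eq_one_iff.mpr ⟨t, ?_⟩)⟩
  rw [hconj, Units.conj_pow, Matrix.diagonal_pow, show d ^ N = fun _ => t from funext ht,
    ← Matrix.scalar_apply, mul_assoc, (Matrix.scalar_commute t (fun r => Commute.all t r) _).eq,
    ← mul_assoc, P.mul_inv, one_mul]

/-- A diagonal matrix with entries `1, β, γ`, as an element of `GL₃(K)`. -/
def diagGL (β γ : Kˣ) : GL3 K where
  val := Matrix.diagonal ![1, β, γ]
  inv := Matrix.diagonal ![1, ↑β⁻¹, ↑γ⁻¹]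
  val_inv := by
    rw [Matrix.diagonal_mul_diagonal, ← Matrix.diagonal_one]
    congr 1
    funext i
    fin_cases i <;> simp
  inv_val := by
    rw [Matrix.diagonal_mul_diagonal, ← Matrix.diagonal_one]
    congr 1
    funext i
    fin_cases i <;> simp

lemma pgl_mk_diagGL_pow_eq_one_iff {β γ : Kˣ} {N : ℕ} :
    (QuotientGroup.mk (diagGL β γ) : PGL3 K) ^ N = 1 ↔ β ^ N = 1 ∧ γ ^ N = 1 := by
  rw [pgl_mk_pow_eq_one_iff, diagGL, Matrix.diagonal_pow]
  constructor
  · rintro ⟨s, hs⟩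
    rw [Matrix.scalar_apply, Matrix.diagonal_eq_diagonal_iff] at hs
    have h0 := hs 0
    have h1 := hs 1
    have h2 := hs 2
    simp only [Pi.pow_apply, Matrix.cons_val, one_pow] at h0 h1 h2
    exact ⟨Units.ext (by simp [h1, h0]), Units.ext (by simp [h2, h0])⟩
  · rintro ⟨hβ, hγ⟩
    refine ⟨1, ?_⟩
    rw [Matrix.scalar_apply, Matrix.diagonal_eq_diagonal_iff]
    intro i
    fin_cases i
    · simp
    · simpa using congrArg Units.val hβ
    · simpa using congrArg Units.val hγ

lemma orderOf_pgl_mk_diagGL {β γ : Kˣ} :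
    orderOf (QuotientGroup.mk (diagGL β γ) : PGL3 K) = (orderOf β).lcm (orderOf γ) := by
  refine Nat.dvd_antisymm (orderOf_dvd_of_pow_eq_one ?_) (Nat.lcm_dvd ?_ ?_)
  · exact pgl_mk_diagGL_pow_eq_one_iff.mpr ⟨orderOf_dvd_iff_pow_eq_one.mp (Nat.dvd_lcm_left _ _),
      orderOf_dvd_iff_pow_eq_one.mp (Nat.dvd_lcm_right _ _)⟩
  · exact orderOf_dvd_of_pow_eq_one (pgl_mk_diagGL_pow_eq_one_iff.mp (pow_orderOf_eq_one _)).1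
  · exact orderOf_dvd_of_pow_eq_one (pgl_mk_diagGL_pow_eq_one_iff.mp (pow_orderOf_eq_one _)).2

end Order

section Examples

lemma matAct_diagGL_X (β γ : Kˣ) (i : Fin 3) :
    matAct (diagGL β γ : Matrix (Fin 3) (Fin 3) K) (X i) = C (![1, (β : K), (γ : K)] i) * X i := by
  simp only [matAct, diagGL, aeval_X]
  rw [Finset.sum_eq_single i]
  · simp
  · intro b _ hb
    simp [Matrix.diagonal_apply_ne _ hb.symm]
  · simp

lemma mk_diagGL_mem_planeAut {F : MvPolynomial (Fin 3) K} {β γ c : Kˣ}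
    (h : aeval (fun i => C (![1, (β : K), (γ : K)] i) * X i) F = C (c : K) * F) :
    (QuotientGroup.mk (diagGL β γ) : PGL3 K) ∈ planeAut F := by
  refine ⟨diagGL β γ, rfl, c, c.ne_zero, ?_⟩
  rw [smul_eq_C_mul, ← h, matAct]
  congr 2
  funext i
  rw [← matAct_diagGL_X, matAct, aeval_X]

lemma exists_unit_orderOf [IsAlgClosed K] [CharZero K] (n : ℕ) [NeZero n] :
    ∃ ζ : Kˣ, orderOf ζ = n := by
  have : NeZero (n : K) := ⟨Nat.cast_ne_zero.mpr (NeZero.ne n)⟩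
  obtain ⟨ζ, hζ⟩ := HasEnoughRootsOfUnity.exists_primitiveRoot K n
  refine ⟨(hζ.isUnit (NeZero.ne n)).unit, ?_⟩
  rw [← orderOf_units, IsUnit.unit_spec, ← hζ.eq_orderOf]

/-- The sextic `X⁵Y + Y⁵Z + Z⁵X`. -/
lemma exists_orderOf_eq_twentyOne [IsAlgClosed K] [CharZero K] :
    ∃ F : MvPolynomial (Fin 3) K, IsSmoothSextic F ∧ ∃ g ∈ planeAut F, orderOf g = 21 := by
  obtain ⟨ζ, hζ⟩ := exists_unit_orderOf (K := K) 21
  have hpow : C (ζ : K) ^ 21 = (1 : MvPolynomial (Fin 3) K) := by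
    rw [← map_pow, ← Units.val_pow_eq_pow_val, ← hζ, pow_orderOf_eq_one, Units.val_one, map_one]
  refine ⟨X 0 ^ 5 * X 1 + X 1 ^ 5 * X 2 + X 2 ^ 5 * X 0, ⟨?_, fun p _ hp => ?_⟩, _,
    mk_diagGL_mem_planeAut (β := ζ ^ 5) (γ := ζ) (c := ζ ^ 5) ?_, ?_⟩
  · exact (((isHomogeneous_X_pow _ 5).mul (isHomogeneous_X _ _)).add
      ((isHomogeneous_X_pow _ 5).mul (isHomogeneous_X _ _))).add
      ((isHomogeneous_X_pow _ 5).mul (isHomogeneous_X _ _))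
  · have h0 := hp 0
    have h1 := hp 1
    have h2 := hp 2
    simp [pderiv_X] at h0 h1 h2
    have hX : p 0 ^ 5 * p 1 = 0 := by
      linear_combination (25 * p 0 * h0 + p 1 * h1 - 5 * p 2 * h2) / 126
    have hp2 : p 2 = 0 := by
      rcases mul_eq_zero.mp hX with h | h <;> simp_all
    have hp1 : p 1 = 0 := by simp_all
    have hp0 : p 0 = 0 := by simp_all
    funext i
    fin_cases i <;> assumption
  · simp
    linear_combination X 1 ^ 5 * X 2 * C (ζ : K) ^ 5 * hpow
  · rw [orderOf_pgl_mk_diagGL, Nat.lcm_eq_right (orderOf_pow_dvd _), hζ]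

/-- The sextic `X⁶ + Y⁵Z + Z⁵Y`. -/
lemma exists_orderOf_eq_twentyFour [IsAlgClosed K] [CharZero K] :
    ∃ F : MvPolynomial (Fin 3) K, IsSmoothSextic F ∧ ∃ g ∈ planeAut F, orderOf g = 24 := by
  obtain ⟨ζ, hζ⟩ := exists_unit_orderOf (K := K) 24
  have hpow : C (ζ : K) ^ 24 = (1 : MvPolynomial (Fin 3) K) := by
    rw [← map_pow, ← Units.val_pow_eq_pow_val, ← hζ, pow_orderOf_eq_one, Units.val_one, map_one]
  refine ⟨X 0 ^ 6 + X 1 ^ 5 * X 2 + X 2 ^ 5 * X 1, ⟨?_, fun p _ hp => ?_⟩, _,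
    mk_diagGL_mem_planeAut (β := ζ ^ 19) (γ := ζ) (c := 1) ?_, ?_⟩
  · exact ((isHomogeneous_X_pow _ 6).add
      ((isHomogeneous_X_pow _ 5).mul (isHomogeneous_X _ _))).add
      ((isHomogeneous_X_pow _ 5).mul (isHomogeneous_X _ _))
  · have h0 := hp 0
    have h1 := hp 1
    have h2 := hp 2
    simp [pderiv_X] at h0 h1 h2
    have hY : p 1 ^ 9 = 0 := by
      linear_combination (24 * p 1 ^ 4 + 5 * p 2 ^ 4) / 24 * h2 - 25 / 24 * p 1 * p 2 ^ 3 * h1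
    have hp1 : p 1 = 0 := by simpa using hY
    have hp2 : p 2 = 0 := by simp_all
    funext i
    fin_cases i <;> assumption
  · simp
    linear_combination (X 2 ^ 5 * X 1 + X 1 ^ 5 * X 2 *
      (C (ζ : K) ^ 72 + C (ζ : K) ^ 48 + C (ζ : K) ^ 24 + 1)) * hpow
  · rw [orderOf_pgl_mk_diagGL, Nat.lcm_eq_right (orderOf_pow_dvd _), hζ]

/-- The sextic `X⁶ + Y⁵X + Z⁵Y`. -/
lemma exists_orderOf_eq_twentyFive [IsAlgClosed K] [CharZero K] :
    ∃ F : MvPolynomial (Fin 3) K, IsSmoothSextic F ∧ ∃ g ∈ planeAut F, orderOf g = 25 := by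
  obtain ⟨ζ, hζ⟩ := exists_unit_orderOf (K := K) 25
  have hpow : C (ζ : K) ^ 25 = (1 : MvPolynomial (Fin 3) K) := by
    rw [← map_pow, ← Units.val_pow_eq_pow_val, ← hζ, pow_orderOf_eq_one, Units.val_one, map_one]
  refine ⟨X 0 ^ 6 + X 1 ^ 5 * X 0 + X 2 ^ 5 * X 1, ⟨?_, fun p _ hp => ?_⟩, _,
    mk_diagGL_mem_planeAut (β := ζ ^ 20) (γ := ζ) (c := 1) ?_, ?_⟩
  · exact ((isHomogeneous_X_pow _ 6).add
      ((isHomogeneous_X_pow _ 5).mul (isHomogeneous_X _ _))).add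
      ((isHomogeneous_X_pow _ 5).mul (isHomogeneous_X _ _))
  · have h0 := hp 0
    have h1 := hp 1
    have h2 := hp 2
    simp [pderiv_X] at h0 h1 h2
    have hp2 : p 2 = 0 := by
      rcases h2 with h | h <;> simp_all
    have hp1 : p 1 = 0 := by
      rw [hp2] at h1
      simp at h1
      rcases h1 with h | h <;> simp_all
    have hp0 : p 0 = 0 := by simp_all
    funext i
    fin_cases i <;> assumption
  · simp
    linear_combination (X 2 ^ 5 * X 1 + X 1 ^ 5 * X 0 *
      (C (ζ : K) ^ 75 + C (ζ : K) ^ 50 + C (ζ : K) ^ 25 + 1)) * hpow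
  · rw [orderOf_pgl_mk_diagGL, Nat.lcm_eq_right (orderOf_pow_dvd _), hζ]

/-- The sextic `X⁶ + Y⁶ + Z⁵X`. -/
lemma exists_orderOf_eq_thirty [IsAlgClosed K] [CharZero K] :
    ∃ F : MvPolynomial (Fin 3) K, IsSmoothSextic F ∧ ∃ g ∈ planeAut F, orderOf g = 30 := by
  obtain ⟨β, hβ⟩ := exists_unit_orderOf (K := K) 6
  obtain ⟨γ, hγ⟩ := exists_unit_orderOf (K := K) 5
  have hβ6 : C (β : K) ^ 6 = (1 : MvPolynomial (Fin 3) K) := by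
    rw [← map_pow, ← Units.val_pow_eq_pow_val, ← hβ, pow_orderOf_eq_one, Units.val_one, map_one]
  have hγ5 : C (γ : K) ^ 5 = (1 : MvPolynomial (Fin 3) K) := by
    rw [← map_pow, ← Units.val_pow_eq_pow_val, ← hγ, pow_orderOf_eq_one, Units.val_one, map_one]
  refine ⟨X 0 ^ 6 + X 1 ^ 6 + X 2 ^ 5 * X 0, ⟨?_, fun p _ hp => ?_⟩, _,
    mk_diagGL_mem_planeAut (β := β) (γ := γ) (c := 1) ?_, ?_⟩
  · exact ((isHomogeneous_X_pow _ 6).add (isHomogeneous_X_pow _ 6)).add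
      ((isHomogeneous_X_pow _ 5).mul (isHomogeneous_X _ _))
  · have h0 := hp 0
    have h1 := hp 1
    have h2 := hp 2
    simp [pderiv_X] at h0 h1 h2
    have hp2 : p 2 = 0 := by
      rcases h2 with h | h <;> simp_all
    have hp0 : p 0 = 0 := by simp_all
    funext i
    fin_cases i <;> assumption
  · simp
    linear_combination X 1 ^ 6 * hβ6 + X 2 ^ 5 * X 0 * hγ5
  · rw [orderOf_pgl_mk_diagGL, hβ, hγ]
    rfl

lemma exists_orderOf_eq_of_dvd {m N : ℕ} (hN : N ≠ 0) (hm : m ∣ N)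
    (h : ∃ F : MvPolynomial (Fin 3) K, IsSmoothSextic F ∧ ∃ g ∈ planeAut F, orderOf g = N) :
    ∃ F : MvPolynomial (Fin 3) K, IsSmoothSextic F ∧ ∃ g ∈ planeAut F, orderOf g = m := by
  obtain ⟨F, hF, g, hg, rfl⟩ := h
  exact ⟨F, hF, g ^ (orderOf g / m), pow_mem hg _, orderOf_pow_orderOf_div hN hm⟩

end Examples


/-- For an integer `m ≥ 2`, there exists a smooth plane sextic over `K` whose
automorphism group contains an element of order exactly `m` if and only if
`m ∈ {2, 3, 4, 5, 6, 7, 8, 10, 12, 15, 21, 24, 25, 30}`. -/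
theorem exists_smooth_sextic_with_automorphism_of_order_iff
    {K : Type*} [Field K] [IsAlgClosed K] [CharZero K] {m : ℕ} (hm : 2 ≤ m) :
    (∃ F : MvPolynomial (Fin 3) K, IsSmoothSextic F ∧ ∃ g ∈ planeAut F, orderOf g = m) ↔
      m ∈ ({2, 3, 4, 5, 6, 7, 8, 10, 12, 15, 21, 24, 25, 30} : Finset ℕ) := by
  constructor
  · rintro ⟨F, hF, g, hg, rfl⟩
    obtain ⟨N, hN, hdvd⟩ := exists_orderOf_dvd hF hg (by omega)
    have hmem : orderOf g ∈ N.divisors.erase 1 :=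
      Finset.mem_erase.mpr ⟨by omega, Nat.mem_divisors.mpr ⟨hdvd, by rintro rfl; simp at hN⟩⟩
    clear hdvd hm
    revert hmem
    generalize orderOf g = m
    clear hg
    revert m N
    decide
  · intro hm'
    have h : m ∣ 21 ∨ m ∣ 24 ∨ m ∣ 25 ∨ m ∣ 30 := by
      clear hm
      revert m
      decide
    rcases h with h | h | h | h
    · exact exists_orderOf_eq_of_dvd (by norm_num) h exists_orderOf_eq_twentyOne
    · exact exists_orderOf_eq_of_dvd (by norm_num) h exists_orderOf_eq_twentyFour
    · exact exists_orderOf_eq_of_dvd (by norm_num) h exists_orderOf_eq_twentyFive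
    · exact exists_orderOf_eq_of_dvd (by norm_num) h exists_orderOf_eq_thirty
end

section
/- The Wiman sextic W₆ defined by 27X⁶ + 9X(Y⁵ + Z⁵) − 135X⁴YZ − 45X²Y²Z² + 10Y³Z³ = 0 is a smooth plane sextic over K, and its automorphism group Aut(W₆) ⊂ PGL₃(K) is isomorphic to the alternating group A₆ on six letters; in particular |Aut(W₆)| = 360. -/
open MvPolynomial

variable {K : Type*} [Field K]

/-- The Wiman sextic `27X⁶ + 9X(Y⁵ + Z⁵) − 135X⁴YZ − 45X²Y²Z² + 10Y³Z³`. -/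
noncomputable def wimanSextic (K : Type*) [Field K] : MvPolynomial (Fin 3) K :=
  27 * X 0 ^ 6 + 9 * X 0 * (X 1 ^ 5 + X 2 ^ 5) - 135 * X 0 ^ 4 * X 1 * X 2
    - 45 * X 0 ^ 2 * X 1 ^ 2 * X 2 ^ 2 + 10 * X 1 ^ 3 * X 2 ^ 3

/-- The value of the Wiman sextic at the point `(x, y, z)`. -/
def wimanVal (x y z : K) : K :=
  27 * x ^ 6 + 9 * x * (y ^ 5 + z ^ 5) - 135 * x ^ 4 * y * z
    - 45 * x ^ 2 * y ^ 2 * z ^ 2 + 10 * y ^ 3 * z ^ 3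

lemma eval_wimanSextic (p : Fin 3 → K) :
    eval p (wimanSextic K) = wimanVal (p 0) (p 1) (p 2) := by
  simp [wimanSextic, wimanVal]

lemma wimanSextic_isHomogeneous : (wimanSextic K).IsHomogeneous 6 := by
  have hC : ∀ c : K, (C c : MvPolynomial (Fin 3) K).IsHomogeneous 0 := isHomogeneous_C _
  have hX : ∀ i, (X i : MvPolynomial (Fin 3) K).IsHomogeneous 1 := isHomogeneous_X _
  have e : wimanSextic K = C 27 * X 0 ^ 6 + C 9 * X 0 * (X 1 ^ 5 + X 2 ^ 5)
      - C 135 * X 0 ^ 4 * X 1 * X 2 - C 45 * X 0 ^ 2 * X 1 ^ 2 * X 2 ^ 2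
      + C 10 * X 1 ^ 3 * X 2 ^ 3 := by
    simp only [wimanSextic, map_ofNat]
  rw [e]
  refine (((IsHomogeneous.add ?_ ?_).sub ?_).sub ?_).add ?_
  · exact (hC 27).mul ((hX 0).pow 6)
  · exact ((hC 9).mul (hX 0)).mul (((hX 1).pow 5).add ((hX 2).pow 5))
  · exact (((hC 135).mul ((hX 0).pow 4)).mul (hX 1)).mul (hX 2)
  · exact (((hC 45).mul ((hX 0).pow 2)).mul ((hX 1).pow 2)).mul ((hX 2).pow 2)
  · exact ((hC 10).mul ((hX 1).pow 3)).mul ((hX 2).pow 3)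

/-- The Jacobian criterion for the Wiman sextic, in coordinates. -/
lemma wimanSextic_singular_eq_zero [CharZero K] {x y z : K}
    (hx : 162 * x ^ 5 + 9 * (y ^ 5 + z ^ 5) - 540 * x ^ 3 * y * z - 90 * x * y ^ 2 * z ^ 2 = 0)
    (hy : 45 * x * y ^ 4 - 135 * x ^ 4 * z - 90 * x ^ 2 * y * z ^ 2 + 30 * y ^ 2 * z ^ 3 = 0)
    (hz : 45 * x * z ^ 4 - 135 * x ^ 4 * y - 90 * x ^ 2 * y ^ 2 * z + 30 * y ^ 3 * z ^ 2 = 0) :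
    x = 0 ∧ y = 0 ∧ z = 0 := by
  by_cases h0 : x = 0
  · subst h0
    have h1 : y ^ 5 + z ^ 5 = 0 := by linear_combination hx / 9
    have h2 : y ^ 2 * z ^ 3 = 0 := by linear_combination hy / 30
    rcases mul_eq_zero.1 h2 with h | h
    · have hy0 : y = 0 := by simpa using h
      subst hy0
      simpa using h1
    · have hz0 : z = 0 := by simpa using h
      subst hz0
      simpa using h1
  exfalso
  have h5 : y ^ 5 = z ^ 5 := by
    have : x * (y ^ 5 - z ^ 5) = 0 := by linear_combination (y * hy - z * hz) / 45
    rcases mul_eq_zero.1 this with h | h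
    · exact absurd h h0
    · linear_combination h
  obtain ⟨t, ht⟩ : ∃ t, y * z = t * x ^ 2 := ⟨y * z / x ^ 2, by field_simp⟩
  have e5 : y ^ 5 = (3 * t + 2 * t ^ 2 - 2 / 3 * t ^ 3) * x ^ 5 := by
    have : x * y ^ 5 = x * ((3 * t + 2 * t ^ 2 - 2 / 3 * t ^ 3) * x ^ 5) := by
      linear_combination y * hy / 45 + (3 * x ^ 4 + 2 * x ^ 2 * (y * z + t * x ^ 2)
        - 2 / 3 * ((y * z) ^ 2 + y * z * (t * x ^ 2) + (t * x ^ 2) ^ 2)) * ht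
    exact mul_left_cancel₀ h0 this
  have q1 : 27 - 81 * t - 9 * t ^ 2 - 2 * t ^ 3 = 0 := by
    have : x ^ 5 * (27 - 81 * t - 9 * t ^ 2 - 2 * t ^ 3) = 0 := by
      linear_combination hx / 6 + 3 / 2 * h5 - 3 * e5
        + (90 * x ^ 3 + 15 * x * (y * z + t * x ^ 2)) * ht
    exact (mul_eq_zero.1 this).resolve_left (pow_ne_zero _ h0)
  have q2 : t ^ 5 = (3 * t + 2 * t ^ 2 - 2 / 3 * t ^ 3) ^ 2 := by
    have : x ^ 10 * t ^ 5 = x ^ 10 * (3 * t + 2 * t ^ 2 - 2 / 3 * t ^ 3) ^ 2 := by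
      have : (y * z) ^ 5 = (t * x ^ 2) ^ 5 := by rw [ht]
      linear_combination -this + y ^ 5 * h5.symm
        + (y ^ 5 + (3 * t + 2 * t ^ 2 - 2 / 3 * t ^ 3) * x ^ 5) * e5
    exact mul_left_cancel₀ (pow_ne_zero _ h0) this
  have ht0 : t ≠ 0 := by
    rintro rfl
    norm_num at q1
  have q3 : t ^ 3 - (3 + 2 * t - 2 / 3 * t ^ 2) ^ 2 = 0 := by
    have : t ^ 2 * (t ^ 3 - (3 + 2 * t - 2 / 3 * t ^ 2) ^ 2) = 0 := by linear_combination q2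
    exact (mul_eq_zero.1 this).resolve_left (pow_ne_zero _ ht0)
  have : (1 : K) = 0 := by
    linear_combination (8 / 675 - 11 / 12150 * t - 13 / 4050 * t ^ 2 + 22 / 54675 * t ^ 3) * q1
      + (-17 / 225 - 7 / 810 * t - 11 / 6075 * t ^ 2) * q3
  exact one_ne_zero this

theorem isSmoothSextic_wimanSextic [CharZero K] : IsSmoothSextic (wimanSextic K) := by
  refine ⟨wimanSextic_isHomogeneous, fun p _ hp => ?_⟩
  have h0 := hp 0
  have h1 := hp 1
  have h2 := hp 2
  simp only [wimanSextic, map_add, map_sub, Derivation.leibniz, Derivation.leibniz_pow,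
    pderiv_X, smul_eq_mul, map_mul, map_pow, eval_X, map_ofNat,
    Pi.single_apply, nsmul_eq_mul] at h0 h1 h2
  simp [← map_ofNat (C (σ := Fin 3) (R := K))] at h0 h1 h2
  obtain ⟨ha, hb, hc⟩ := wimanSextic_singular_eq_zero (x := p 0) (y := p 1) (z := p 2)
    (by linear_combination h0) (by linear_combination h1) (by linear_combination h2)
  funext i
  fin_cases i <;> assumption

lemma exists_fifth_root_of_unity_mul {ζ a b : K} (hζ : 1 + ζ + ζ ^ 2 + ζ ^ 3 + ζ ^ 4 = 0)
    (h : a ^ 5 = b ^ 5) : ∃ i : Fin 5, a = b * ζ ^ (i : ℕ) := by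
  have : (a - b * ζ ^ 0) * ((a - b * ζ ^ 1) * ((a - b * ζ ^ 2) * ((a - b * ζ ^ 3)
      * (a - b * ζ ^ 4)))) = 0 := by
    linear_combination h + (a * b ^ 4 * ζ ^ 6 - b ^ 5 * ζ ^ 6 - a ^ 2 * b ^ 3 * ζ ^ 5
      + b ^ 5 * ζ ^ 5 + a ^ 3 * b ^ 2 * ζ ^ 3 - a ^ 2 * b ^ 3 * ζ ^ 3 + a ^ 3 * b ^ 2 * ζ - b ^ 5 * ζ - a ^ 4 * b + b ^ 5) * hζ
  simp only [mul_eq_zero, sub_eq_zero] at this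
  rcases this with h | h | h | h | h
  exacts [⟨0, h⟩, ⟨1, h⟩, ⟨2, h⟩, ⟨3, h⟩, ⟨4, h⟩]

/-- A binary sextic form which vanishes identically has zero coefficients. -/
lemma binary_sextic_coeff_eq_zero [CharZero K] {c₀ c₁ c₂ c₃ c₄ c₅ c₆ : K}
    (h : ∀ y z : K, c₀ * y ^ 6 + c₁ * y ^ 5 * z + c₂ * y ^ 4 * z ^ 2 + c₃ * y ^ 3 * z ^ 3
      + c₄ * y ^ 2 * z ^ 4 + c₅ * y * z ^ 5 + c₆ * z ^ 6 = 0) :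
    c₀ = 0 ∧ c₁ = 0 ∧ c₂ = 0 ∧ c₃ = 0 ∧ c₄ = 0 ∧ c₅ = 0 ∧ c₆ = 0 := by
  have h0 := h 0 1
  have h1 := h 1 1
  have h2 := h (-1) 1
  have h3 := h 2 1
  have h4 := h (-2) 1
  have h5 := h 3 1
  have h6 := h (-3) 1
  refine ⟨?_, ?_, ?_, ?_, ?_, ?_, ?_⟩
  · linear_combination (-1/36) * h0 + (1/48) * h1 + (1/48) * h2 + (-1/120) * h3 + (-1/120) * h4
      + (1/720) * h5 + (1/720) * h6
  · linear_combination (1/48) * h1 + (-1/48) * h2 + (-1/60) * h3 + (1/60) * h4 + (1/240) * h5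
      + (-1/240) * h6
  · linear_combination (7/18) * h0 + (-13/48) * h1 + (-13/48) * h2 + (1/12) * h3 + (1/12) * h4
      + (-1/144) * h5 + (-1/144) * h6
  · linear_combination (-13/48) * h1 + (13/48) * h2 + (1/6) * h3 + (-1/6) * h4 + (-1/48) * h5
      + (1/48) * h6
  · linear_combination (-49/36) * h0 + (3/4) * h1 + (3/4) * h2 + (-3/40) * h3 + (-3/40) * h4
      + (1/180) * h5 + (1/180) * h6
  · linear_combination (3/4) * h1 + (-3/4) * h2 + (-3/20) * h3 + (3/20) * h4 + (1/60) * h5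
      + (-1/60) * h6
  · linear_combination (1) * h0

/-- The restriction of the Wiman sextic to the line `α x + β y + γ z = 0` is the cube of a
product of two linear forms. -/
def IsCubeRow (α β γ : K) : Prop :=
  ∃ p₁ p₂ p₃ q₁ q₂ q₃ : K, ∀ x y z, α * x + β * y + γ * z = 0 →
    wimanVal x y z = ((p₁ * x + p₂ * y + p₃ * z) * (q₁ * x + q₂ * y + q₃ * z)) ^ 3

lemma IsCubeRow.eq_zero_of_fst_eq_zero [CharZero K] {β γ : K} (h : IsCubeRow 0 β γ) :
    β = 0 ∧ γ = 0 := by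
  obtain ⟨p₁, p₂, p₃, q₁, q₂, q₃, h⟩ := h
  set A := p₁ * q₁ with hA
  set B := p₁ * (q₂ * γ - q₃ * β) + q₁ * (p₂ * γ - p₃ * β) with hB
  set D := (p₂ * γ - p₃ * β) * (q₂ * γ - q₃ * β) with hD
  obtain ⟨e0, e1, e2, -, e4, e5, -⟩ := binary_sextic_coeff_eq_zero (K := K)
    (c₀ := 27 - A ^ 3) (c₁ := -3 * A ^ 2 * B) (c₂ := 135 * γ * β - 3 * A ^ 2 * D - 3 * A * B ^ 2)
    (c₃ := - 6 * A * B * D - B ^ 3)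
    (c₄ := - 45 * γ ^ 2 * β ^ 2 - 3 * A * D ^ 2 - 3 * B ^ 2 * D)
    (c₅ := 9 * (γ ^ 5 - β ^ 5) - 3 * B * D ^ 2) (c₆ := - 10 * γ ^ 3 * β ^ 3 - D ^ 3)
    (fun x t => by
      have := h x (γ * t) (-β * t) (by ring)
      rw [wimanVal] at this
      rw [hA, hB, hD]
      linear_combination this)
  have hA0 : A ≠ 0 := by
    intro h
    rw [h] at e0
    norm_num at e0
  have hB0 : B = 0 := by simpa [hA0] using e1
  rw [hB0] at e2 e4 e5
  have h1 : (γ * β) ^ 2 = 0 := by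
    linear_combination ((135 * γ * β + 3 * A ^ 2 * D) * e2 - 3 * A ^ 3 * e4
      + 135 * γ ^ 2 * β ^ 2 * e0) / 21870
  have h2 : γ ^ 5 = β ^ 5 := by linear_combination e5 / 9
  rcases mul_eq_zero.1 (pow_eq_zero_iff two_ne_zero |>.1 h1) with h | h <;> rw [h] at h2 ⊢
  · exact ⟨by simpa using h2.symm, rfl⟩
  · exact ⟨rfl, by simpa using h2⟩

/-- The restriction of the Wiman sextic to the line `x = a y + b z` is the cube of the binary
quadratic form with coefficients `A, B, D`. -/
def IsCubeLine (a b A B D : K) : Prop :=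
  ∀ y z, wimanVal (a * y + b * z) y z = (A * y ^ 2 + B * y * z + D * z ^ 2) ^ 3

lemma IsCubeRow.exists_isCubeLine {α β γ : K} (h : IsCubeRow α β γ) (hα : α ≠ 0) :
    ∃ A B D, IsCubeLine (-β / α) (-γ / α) A B D := by
  obtain ⟨p₁, p₂, p₃, q₁, q₂, q₃, h⟩ := h
  refine ⟨(p₁ * (-β / α) + p₂) * (q₁ * (-β / α) + q₂),
    (p₁ * (-β / α) + p₂) * (q₁ * (-γ / α) + q₃) + (p₁ * (-γ / α) + p₃) * (q₁ * (-β / α) + q₂),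
    (p₁ * (-γ / α) + p₃) * (q₁ * (-γ / α) + q₃), fun y z => ?_⟩
  rw [h _ y z (by field_simp; ring)]
  ring

lemma IsCubeLine.coeff [CharZero K] {a b A B D : K} (h : IsCubeLine a b A B D) :
    27 * a ^ 6 + 9 * a = A ^ 3 ∧
    162 * a ^ 5 * b + 9 * b - 135 * a ^ 4 = 3 * A ^ 2 * B ∧
    a ^ 2 * (405 * (a * b) ^ 2 - 540 * (a * b) - 45) = 3 * A * (A * D + B ^ 2) ∧
    540 * (a * b) ^ 3 - 810 * (a * b) ^ 2 - 90 * (a * b) + 10 = 6 * A * B * D + B ^ 3 ∧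
    b ^ 2 * (405 * (a * b) ^ 2 - 540 * (a * b) - 45) = 3 * D * (A * D + B ^ 2) ∧
    162 * b ^ 5 * a + 9 * a - 135 * b ^ 4 = 3 * D ^ 2 * B ∧
    27 * b ^ 6 + 9 * b = D ^ 3 := by
  obtain ⟨e0, e1, e2, e3, e4, e5, e6⟩ := binary_sextic_coeff_eq_zero (K := K)
    (c₀ := 27 * a ^ 6 + 9 * a - A ^ 3)
    (c₁ := 162 * a ^ 5 * b + 9 * b - 135 * a ^ 4 - 3 * A ^ 2 * B)
    (c₂ := a ^ 2 * (405 * (a * b) ^ 2 - 540 * (a * b) - 45) - 3 * A * (A * D + B ^ 2))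
    (c₃ := 540 * (a * b) ^ 3 - 810 * (a * b) ^ 2 - 90 * (a * b) + 10 - (6 * A * B * D + B ^ 3))
    (c₄ := b ^ 2 * (405 * (a * b) ^ 2 - 540 * (a * b) - 45) - 3 * D * (A * D + B ^ 2))
    (c₅ := 162 * b ^ 5 * a + 9 * a - 135 * b ^ 4 - 3 * D ^ 2 * B)
    (c₆ := 27 * b ^ 6 + 9 * b - D ^ 3)
    (fun y z => by
      have := h y z
      rw [wimanVal] at this
      linear_combination this)
  simp only [sub_eq_zero] at *
  exact ⟨e0, e1, e2, e3, e4, e5, e6⟩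

lemma wimanVal_rotate {η : K} (hη : η ^ 5 = 1) (x y z : K) :
    wimanVal x (η * y) (η ^ 4 * z) = wimanVal x y z := by
  rw [wimanVal, wimanVal]
  linear_combination (9 * x * y ^ 5 + 9 * x * z ^ 5 * (η ^ 15 + η ^ 10 + η ^ 5 + 1)
    - 135 * x ^ 4 * y * z - 45 * x ^ 2 * y ^ 2 * z ^ 2 * (η ^ 5 + 1)
    + 10 * y ^ 3 * z ^ 3 * (η ^ 10 + η ^ 5 + 1)) * hη

lemma IsCubeLine.rotate {a b A B D η : K} (hη : η ^ 5 = 1) (h : IsCubeLine a b A B D) :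
    IsCubeLine (a * η) (b * η ^ 4) (A * η ^ 2) B (D * η ^ 3) := by
  intro y z
  rw [← wimanVal_rotate hη, show A * η ^ 2 * y ^ 2 + B * y * z + D * η ^ 3 * z ^ 2
      = A * (η * y) ^ 2 + B * (η * y) * (η ^ 4 * z) + D * (η ^ 4 * z) ^ 2 by
    linear_combination -(B * y * z + D * η ^ 3 * z ^ 2) * hη, ← h]
  congr 1
  ring

/-- The cubic equation satisfied by the lines `x = a (y + z)` on which the Wiman sextic is a
cube. -/
lemma IsCubeLine.symmetric [CharZero K] {a A B D : K} (h : IsCubeLine a a A B D) (ha : a ≠ 0)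
    (hAD : A = D) : (3 * a + 1) * (3 * a ^ 2 - 3 * a + 2) = 0 := by
  subst hAD
  obtain ⟨e0, e1, e2, e3, -⟩ := h.coeff
  obtain ⟨n, hn⟩ : ∃ n, n = B - 2 * A := ⟨_, rfl⟩
  have h1 : n ^ 3 = 10 := by rw [hn]; linear_combination 2 * e0 - 2 * e1 + 2 * e2 - e3
  have h2 : A ^ 2 * n = -15 * a - 45 * a ^ 4 := by
    rw [hn]; linear_combination 2 * e0 - e1 / 3
  have h3 : A * n ^ 2 = 15 * a - 15 * a ^ 2 := by
    rw [hn]; linear_combination -3 * e0 + 4 / 3 * e1 - e2 / 3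
  have : 75 * a * ((3 * a + 1) * (3 * a ^ 2 - 3 * a + 2)) = 0 := by
    linear_combination n ^ 3 * h2 - (15 * a - 15 * a ^ 2 + A * n ^ 2) * h3
      - (15 * a + 45 * a ^ 4) * h1
  exact (mul_eq_zero.1 this).resolve_left (mul_ne_zero (by norm_num) ha)

/-- The lines `x = a y + b z` on which the Wiman sextic is a cube, other than `x = 0`, satisfy
`a ^ 5 = b ^ 5` or have `a b` among two values. -/
lemma IsCubeLine.dichotomy [CharZero K] {a b A B D : K} (h : IsCubeLine a b A B D)
    (ha : a ≠ 0) (hb : b ≠ 0) (ht : 9 * (a * b) ^ 2 - 12 * (a * b) - 1 ≠ 0) :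
    a ^ 2 * D = b ^ 2 * A ∧ a ^ 5 = b ^ 5 := by
  obtain ⟨e0, -, e2, -, e4, -, e6⟩ := h.coeff
  have h1 : a ^ 2 * D = b ^ 2 * A := by
    have : (9 * (a * b) ^ 2 - 12 * (a * b) - 1) * (a ^ 2 * D - b ^ 2 * A) = 0 := by
      linear_combination (D * e2 - A * e4) / 45
    linear_combination (mul_eq_zero.1 this).resolve_left ht
  refine ⟨h1, ?_⟩
  have h2 : (a ^ 2 * D) ^ 3 = (b ^ 2 * A) ^ 3 := by rw [h1]
  have : a * b * (a ^ 5 - b ^ 5) = 0 := by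
    linear_combination (h2 + a ^ 6 * e6 - b ^ 6 * e0) / 9
  rcases mul_eq_zero.1 this with h | h
  · exact absurd h (mul_ne_zero ha hb)
  · linear_combination h

lemma IsCubeLine.ne_zero [CharZero K] {b A B D : K} (h : IsCubeLine 0 b A B D) : b = 0 := by
  obtain ⟨e0, e1, -⟩ := h.coeff
  have hA : A = 0 := by
    have : A ^ 3 = 0 := by linear_combination -e0
    simpa using this
  rw [hA] at e1
  linear_combination e1 / 9

lemma IsCubeLine.swap {a b A B D : K} (h : IsCubeLine a b A B D) : IsCubeLine b a D B A := by
  intro y z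
  have := h z y
  rw [wimanVal] at *
  linear_combination this

/-- In the exceptional case of `IsCubeLine.dichotomy`, the value `a b` determines
`a ^ 5 + b ^ 5`. -/
lemma IsCubeLine.exceptional [CharZero K] {a b A B D : K} (h : IsCubeLine a b A B D)
    (ht : 9 * (a * b) ^ 2 - 12 * (a * b) - 1 = 0) :
    (18 * (a * b) - 15) * (a ^ 5 + b ^ 5)
      = 100 * (a * b) ^ 2 - a * b - (18 * (a * b) - 15) ^ 2 * (a * b) ^ 4 := by
  obtain ⟨e0, e1, e2, e3, e4, e5, e6⟩ := h.coeff
  have ht0 : a * b ≠ 0 := by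
    intro h
    rw [h] at ht
    norm_num at ht
  have ha : a ≠ 0 := left_ne_zero_of_mul ht0
  have hb : b ≠ 0 := right_ne_zero_of_mul ht0
  have hAD : A * D + B ^ 2 = 0 := by
    by_contra hne
    have hA : A = 0 := by
      have : 3 * (A * D + B ^ 2) * A = 0 := by linear_combination -e2 + 45 * a ^ 2 * ht
      simpa [hne] using this
    rw [hA] at e0 e1
    have h1 : 3 * a ^ 5 = -1 := by
      have : a * (3 * a ^ 5 + 1) = 0 := by linear_combination e0 / 9
      linear_combination (mul_eq_zero.1 this).resolve_left ha
    have h2 : a * b = 1 := by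
      linear_combination (-a * e1 + (54 * (a * b) - 45) * h1) / 45
    rw [h2] at ht
    norm_num at ht
  have hB : B ^ 3 = 30 * (a * b) := by
    linear_combination (e3 + 6 * B * hAD) / 5 + (2 - 12 * (a * b)) * ht
  have : a * b * ((18 * (a * b) - 15) * (a ^ 5 + b ^ 5)) = a * b * (100 * (a * b) ^ 2 - a * b
      - (18 * (a * b) - 15) ^ 2 * (a * b) ^ 4) := by
    have h : a * (162 * a ^ 5 * b + 9 * b - 135 * a ^ 4)
        * (b * (162 * b ^ 5 * a + 9 * a - 135 * b ^ 4))
        = a * (3 * A ^ 2 * B) * (b * (3 * D ^ 2 * B)) := by rw [e1, e5]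
    linear_combination h / 81 + a * b / 9 * B ^ 2 * (A * D - B ^ 2) * hAD
      + a * b / 9 * (B ^ 3 + 30 * (a * b)) * hB
  exact mul_left_cancel₀ ht0 this

lemma wimanVal_swap (x y z : K) : wimanVal x z y = wimanVal x y z := by
  rw [wimanVal, wimanVal]
  ring

lemma eq_of_wimanVal_diagonal [CharZero K] {c p q p' r : K} (hq : q ≠ 0) (hr : r ≠ 0)
    (h : ∀ x y z, wimanVal x (p * x + q * y) (p' * x + r * z) = c * wimanVal x y z) :
    p = 0 ∧ p' = 0 ∧ q ^ 5 = 1 ∧ r = q ^ 4 := by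
  obtain ⟨-, h5, h4, -⟩ := binary_sextic_coeff_eq_zero (K := K) (c₀ := 0)
    (c₁ := 9 * q ^ 5 - 9 * c) (c₂ := 45 * p * q ^ 4)
    (c₃ := 90 * p ^ 2 * q ^ 3 + 10 * p' ^ 3 * q ^ 3)
    (c₄ := 90 * p ^ 3 * q ^ 2 - 45 * p' ^ 2 * q ^ 2 + 30 * p * q ^ 2 * p' ^ 3)
    (c₅ := 45 * p ^ 4 * q - 135 * p' * q - 90 * p * p' ^ 2 * q + 30 * p ^ 2 * q * p' ^ 3)
    (c₆ := 27 + 9 * (p ^ 5 + p' ^ 5) - 135 * p * p' - 45 * p ^ 2 * p' ^ 2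
      + 10 * p ^ 3 * p' ^ 3 - 27 * c)
    (fun y x => by
      have := h x y 0
      rw [wimanVal, wimanVal] at this
      linear_combination this)
  obtain ⟨-, -, h4', -⟩ := binary_sextic_coeff_eq_zero (K := K) (c₀ := 0)
    (c₁ := 9 * r ^ 5 - 9 * c) (c₂ := 45 * p' * r ^ 4)
    (c₃ := 90 * p' ^ 2 * r ^ 3 + 10 * p ^ 3 * r ^ 3)
    (c₄ := 90 * p' ^ 3 * r ^ 2 - 45 * p ^ 2 * r ^ 2 + 30 * p' * r ^ 2 * p ^ 3)
    (c₅ := 45 * p' ^ 4 * r - 135 * p * r - 90 * p' * p ^ 2 * r + 30 * p' ^ 2 * r * p ^ 3)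
    (c₆ := 27 + 9 * (p ^ 5 + p' ^ 5) - 135 * p * p' - 45 * p ^ 2 * p' ^ 2
      + 10 * p ^ 3 * p' ^ 3 - 27 * c)
    (fun z x => by
      have := h x 0 z
      rw [wimanVal, wimanVal] at this
      linear_combination this)
  have hp : p = 0 := by simpa [hq] using h4
  have hp' : p' = 0 := by simpa [hr] using h4'
  subst hp hp'
  have hc : c = 1 := by
    have := h 1 0 0
    rw [wimanVal, wimanVal] at this
    linear_combination -this / 27
  subst hc
  have hq5 : q ^ 5 = 1 := by linear_combination h5 / 9
  refine ⟨rfl, rfl, hq5, ?_⟩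
  have hr5 : r ^ 5 = 1 := by
    have := h 1 0 1
    rw [wimanVal, wimanVal] at this
    linear_combination this / 9
  have hqr : q * r = 1 := by
    have h1 := h 1 1 1
    have h2 := h 1 1 (-1)
    have h3 := h 1 1 2
    rw [wimanVal, wimanVal] at h1 h2 h3
    linear_combination -h1 / 135 + h2 / 405 + h3 / 810 + hq5 / 30 - 4 / 15 * hr5
  linear_combination q ^ 4 * hqr - r * hq5

lemma eq_of_wimanVal_linear [CharZero K] {c p q r p' q' r' : K} (hdet : q * r' - r * q' ≠ 0)
    (h : ∀ x y z, wimanVal x (p * x + q * y + r * z) (p' * x + q' * y + r' * z)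
      = c * wimanVal x y z) :
    p = 0 ∧ p' = 0 ∧ ((r = 0 ∧ q' = 0 ∧ q ^ 5 = 1 ∧ r' = q ^ 4)
      ∨ (q = 0 ∧ r' = 0 ∧ r ^ 5 = 1 ∧ q' = r ^ 4)) := by
  have h1 : q = 0 ∨ q' = 0 := by
    have := h 0 1 0
    rw [wimanVal, wimanVal] at this
    have : (q * q') ^ 3 = 0 := by linear_combination this / 10
    simpa using this
  have h2 : r = 0 ∨ r' = 0 := by
    have := h 0 0 1
    rw [wimanVal, wimanVal] at this
    have : (r * r') ^ 3 = 0 := by linear_combination this / 10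
    simpa using this
  rcases h1 with h1 | h1 <;> rcases h2 with h2 | h2 <;> subst h1 h2
  · simp at hdet
  · obtain ⟨rfl, rfl, h5, h4⟩ := eq_of_wimanVal_diagonal (c := c) (p := p) (p' := p') (q := r)
      (r := q') (by rintro rfl; simp at hdet) (by rintro rfl; simp at hdet) (fun x y z => by
        rw [← wimanVal_swap x y z, ← h x z y]
        congr 1 <;> ring)
    exact ⟨rfl, rfl, Or.inr ⟨rfl, rfl, h5, h4⟩⟩
  · obtain ⟨rfl, rfl, h5, h4⟩ := eq_of_wimanVal_diagonal (c := c) (p := p) (p' := p') (q := q)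
      (r := r') (by rintro rfl; simp at hdet) (by rintro rfl; simp at hdet) (fun x y z => by
        rw [← h x y z]
        congr 1 <;> ring)
    exact ⟨rfl, rfl, Or.inl ⟨rfl, rfl, h5, h4⟩⟩
  · simp at hdet

/-- The group of matrices preserving the Wiman sextic up to a scalar. -/
def wimanStabilizer (K : Type*) [Field K] : Subgroup (GL3 K) where
  carrier := {A | ∃ c : K, c ≠ 0 ∧ ∀ v : Fin 3 → K,
    wimanVal (A.1.mulVec v 0) (A.1.mulVec v 1) (A.1.mulVec v 2)
      = c * wimanVal (v 0) (v 1) (v 2)}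
  one_mem' := ⟨1, one_ne_zero, fun v => by simp⟩
  mul_mem' := by
    rintro A B ⟨c, hc, hA⟩ ⟨d, hd, hB⟩
    refine ⟨c * d, mul_ne_zero hc hd, fun v => ?_⟩
    rw [Units.val_mul, ← Matrix.mulVec_mulVec, hA, hB, mul_assoc]
  inv_mem' := by
    rintro A ⟨c, hc, hA⟩
    refine ⟨c⁻¹, inv_ne_zero hc, fun v => ?_⟩
    rw [eq_inv_mul_iff_mul_eq₀ hc, ← hA, Matrix.mulVec_mulVec, ← Units.val_mul,
      mul_inv_cancel, Units.val_one, Matrix.one_mulVec]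

lemma mem_wimanStabilizer {A : GL3 K} : A ∈ wimanStabilizer K ↔ ∃ c : K, c ≠ 0 ∧
    ∀ v : Fin 3 → K, wimanVal (A.1.mulVec v 0) (A.1.mulVec v 1) (A.1.mulVec v 2)
      = c * wimanVal (v 0) (v 1) (v 2) := Iff.rfl

lemma mem_wimanStabilizer_iff_matAct [CharZero K] {A : GL3 K} : A ∈ wimanStabilizer K ↔
    ∃ c : K, c ≠ 0 ∧ matAct A.1 (wimanSextic K) = c • wimanSextic K := by
  rw [mem_wimanStabilizer]
  refine exists_congr fun c => and_congr_right fun _ => ⟨fun h => funext fun v => ?_,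
    fun h v => ?_⟩
  · rw [eval_matAct, smul_eval, eval_wimanSextic, eval_wimanSextic, h]
  · rw [← eval_wimanSextic, ← eval_matAct, h, smul_eval, eval_wimanSextic]

lemma isCubeRow_of_mem [IsAlgClosed K] {A : GL3 K} (hA : A ∈ wimanStabilizer K) :
    IsCubeRow (A.1 0 0) (A.1 0 1) (A.1 0 2) := by
  obtain ⟨c, hc, hA⟩ := hA
  obtain ⟨κ, hκ⟩ := IsAlgClosed.exists_pow_nat_eq (10 / c) (n := 3) (by norm_num)
  refine ⟨κ * A.1 1 0, κ * A.1 1 1, κ * A.1 1 2, A.1 2 0, A.1 2 1, A.1 2 2,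
    fun x y z hxyz => ?_⟩
  have h := hA ![x, y, z]
  simp only [Matrix.mulVec, dotProduct, Fin.sum_univ_three, Matrix.cons_val_zero,
    Matrix.cons_val_one, Matrix.cons_val] at h
  rw [hxyz] at h
  refine mul_left_cancel₀ hc ?_
  rw [← h, wimanVal]
  have hκ' : κ ^ 3 * c = 10 := by rw [hκ]; field_simp
  linear_combination -((A.1 1 0 * x + A.1 1 1 * y + A.1 1 2 * z)
    * (A.1 2 0 * x + A.1 2 1 * y + A.1 2 2 * z)) ^ 3 * hκ'

lemma wimanVal_eq_symmetric (x y z : K) : wimanVal x y z = 27 * x ^ 6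
    + 9 * x * ((y + z) ^ 5 - 5 * (y + z) ^ 3 * (y * z) + 5 * (y + z) * (y * z) ^ 2)
    - 135 * x ^ 4 * (y * z) - 45 * x ^ 2 * (y * z) ^ 2 + 10 * (y * z) ^ 3 := by
  rw [wimanVal]
  ring

lemma wimanVal_reflection {s g x y z : K} (hs : 3 * s ^ 2 + 3 * s + 2 = 0)
    (hg : g ^ 2 + g - 1 = 0) :
    wimanVal (x + s * y + s * z) (-(3 * s + 3) * x + (-1 - g) * y + g * z)
      (-(3 * s + 3) * x + g * y + (-1 - g) * z) = 125 * wimanVal x y z := by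
  have h1 : (-(3 * s + 3) * x + (-1 - g) * y + g * z) + (-(3 * s + 3) * x + g * y + (-1 - g) * z)
      = -(6 * s + 6) * x - (y + z) := by ring
  have h2 : (-(3 * s + 3) * x + (-1 - g) * y + g * z) * (-(3 * s + 3) * x + g * y + (-1 - g) * z)
      = (3 * s + 3) ^ 2 * x ^ 2 + (3 * s + 3) * x * (y + z) - (y + z) ^ 2 + 5 * (y * z) := by
    linear_combination (2 * y * z - y ^ 2 - z ^ 2) * hg
  have h3 : x + s * y + s * z = x + s * (y + z) := by ring
  rw [wimanVal_eq_symmetric, wimanVal_eq_symmetric x, h1, h2, h3]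
  generalize y + z = e
  generalize y * z = f
  linear_combination (9 * e ^ 6 * s ^ 4 - 1458 * e * s ^ 4 * x ^ 5 - 405 * e ^ 4 * s ^ 4 * x ^ 2
    - 1215 * e ^ 2 *
    s ^ 4 * x ^ 4 + 2430 * s ^ 4 * x ^ 6 - 81 * e ^ 5 * s ^ 3 * x + 10692 * s ^ 3 * x ^ 6 -
    5832 * e * s ^ 3 * x ^ 5 - 4860 * e ^ 2 * s ^ 3 * x ^ 4 - 2430 * e ^ 3 * s ^ 3 * x ^ 3 -
    405 * e ^ 4 * s ^ 3 * x ^ 2 - 9 * e ^ 6 * s ^ 3 + 15633 * s ^ 2 * x ^ 6 - 6561 * e * s ^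
    2 * x ^ 5 - 10530 * e ^ 2 * s ^ 2 * x ^ 4 - 5670 * e ^ 3 * s ^ 2 * x ^ 3 + 8100 * e * f
    * s ^ 2 * x ^ 3 - 54 * e ^ 5 * s ^ 2 * x + 48 * e ^ 6 * s ^ 2 - 225 * e ^ 4 * f * s ^ 2
    - 1350 * e ^ 2 * f * s ^ 2 * x ^ 2 + 4050 * f * s ^ 2 * x ^ 4 - 4860 * e ^ 3 * s * x ^ 3
    + 6399 * s * x ^ 6 - 1701 * e * s * x ^ 5 - 10530 * e ^ 2 * s * x ^ 4 + 20250 * f * s *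
    x ^ 4 - 1080 * e ^ 4 * s * x ^ 2 + 16200 * e * f * s * x ^ 3 + 2700 * e ^ 2 * f * s * x
    ^ 2 + 378 * e ^ 5 * s * x - 1350 * e ^ 3 * f * s * x - 42 * e ^ 6 * s + 225 * e ^ 4 * f
    * s - 3375 * e ^ 2 * x ^ 4 - 2646 * x ^ 6 + 405 * e * x ^ 5 - 2160 * e ^ 3 * x ^ 3 +
    24300 * f * x ^ 4 + 9450 * e * f * x ^ 3 - 495 * e ^ 4 * x ^ 2 - 567 * e ^ 5 * x + 2250
    * e ^ 2 * f * x ^ 2 + 2700 * e ^ 3 * f * x - 2250 * e * f ^ 2 * x - 5 * e ^ 6 + 75 * e ^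
    4 * f - 375 * e ^ 2 * f ^ 2 + 2250 * f ^ 2 * x ^ 2) * hs

/-- A primitive fifth root of unity `ζ` together with a root `s` of `3 s² + 3 s + 2`; these
generate the field of definition of the automorphisms of the Wiman sextic. -/
structure WimanData (K : Type*) [Field K] where
  /-- the fifth root of unity -/
  ζ : K
  /-- the root of `3 s² + 3 s + 2` -/
  s : K
  hζ : 1 + ζ + ζ ^ 2 + ζ ^ 3 + ζ ^ 4 = 0
  hs : 3 * s ^ 2 + 3 * s + 2 = 0

lemma nonempty_wimanData [IsAlgClosed K] [CharZero K] : Nonempty (WimanData K) := by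
  obtain ⟨r, hr⟩ := IsAlgClosed.exists_pow_nat_eq (5 : K) (n := 2) (by norm_num)
  obtain ⟨q, hq⟩ := IsAlgClosed.exists_pow_nat_eq (((r - 1) / 2) ^ 2 - 4 : K) (n := 2)
    (by norm_num)
  obtain ⟨m, hm⟩ := IsAlgClosed.exists_pow_nat_eq (-15 : K) (n := 2) (by norm_num)
  refine ⟨⟨((r - 1) / 2 + q) / 2, (-3 + m) / 6, ?_, by linear_combination hm / 12⟩⟩
  obtain ⟨g, hg⟩ : ∃ g, g = (r - 1) / 2 := ⟨_, rfl⟩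
  rw [← hg] at hq ⊢
  have h1 : g ^ 2 + g - 1 = 0 := by rw [hg]; linear_combination hr / 4
  obtain ⟨ζ, hζ⟩ : ∃ ζ, ζ = (g + q) / 2 := ⟨_, rfl⟩
  rw [← hζ]
  have h2 : ζ ^ 2 - g * ζ + 1 = 0 := by rw [hζ]; linear_combination hq / 4
  linear_combination (ζ ^ 2 + (1 + g) * ζ + 1) * h2 + ζ ^ 2 * h1

namespace WimanData

variable (D : WimanData K)

lemma ζ_pow_five : D.ζ ^ 5 = 1 := by linear_combination (D.ζ - 1) * D.hζ

lemma golden : (D.ζ + D.ζ ^ 4) ^ 2 + (D.ζ + D.ζ ^ 4) - 1 = 0 := by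
  linear_combination (D.ζ ^ 4 - D.ζ ^ 3 + 2 * D.ζ - 1) * D.hζ

/-- The diagonal automorphism of order five. -/
def rot : GL3 K where
  val := !![1, 0, 0; 0, D.ζ, 0; 0, 0, D.ζ ^ 4]
  inv := !![1, 0, 0; 0, D.ζ ^ 4, 0; 0, 0, D.ζ]
  val_inv := by
    ext i j; fin_cases i <;> fin_cases j <;>
      simp [Matrix.mul_apply, Fin.sum_univ_three, ← pow_succ, ← pow_succ', D.ζ_pow_five]
  inv_val := by
    ext i j; fin_cases i <;> fin_cases j <;>
      simp [Matrix.mul_apply, Fin.sum_univ_three, ← pow_succ, ← pow_succ', D.ζ_pow_five]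

/-- The automorphism exchanging the last two coordinates. -/
def flip (_ : WimanData K) : GL3 K where
  val := !![1, 0, 0; 0, 0, 1; 0, 1, 0]
  inv := !![1, 0, 0; 0, 0, 1; 0, 1, 0]
  val_inv := by
    ext i j; fin_cases i <;> fin_cases j <;> simp [Matrix.mul_apply, Fin.sum_univ_three]
  inv_val := by
    ext i j; fin_cases i <;> fin_cases j <;> simp [Matrix.mul_apply, Fin.sum_univ_three]

/-- The matrix of an involution of the Wiman sextic, up to a scalar. -/
def reflMatrix (s g : K) : Matrix (Fin 3) (Fin 3) K :=
  !![1, s, s; -(3 * s + 3), -1 - g, g; -(3 * s + 3), g, -1 - g]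

lemma reflMatrix_mul_self {s g : K} (hs : 3 * s ^ 2 + 3 * s + 2 = 0) (hg : g ^ 2 + g - 1 = 0) :
    reflMatrix s g * reflMatrix s g = (5 : K) • 1 := by
  ext i j; fin_cases i <;> fin_cases j <;>
    simp [reflMatrix, Matrix.mul_apply, Fin.sum_univ_three]
  · linear_combination -2 * hs
  · ring
  · ring
  · ring
  · linear_combination 2 * hg - hs
  · linear_combination -2 * hg - hs
  · ring
  · linear_combination -2 * hg - hs
  · linear_combination 2 * hg - hs

lemma rot_mem : D.rot ∈ wimanStabilizer K := by
  refine ⟨1, one_ne_zero, fun v => ?_⟩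
  rw [one_mul, ← wimanVal_rotate D.ζ_pow_five (v 0)]
  congr 1 <;> simp [rot, Matrix.mulVec, dotProduct, Fin.sum_univ_three]

variable [CharZero K]

/-- The unit attached to `reflMatrix`. -/
def reflUnit {s g : K} (hs : 3 * s ^ 2 + 3 * s + 2 = 0) (hg : g ^ 2 + g - 1 = 0) : GL3 K where
  val := reflMatrix s g
  inv := (5 : K)⁻¹ • reflMatrix s g
  val_inv := by
    rw [Matrix.mul_smul, reflMatrix_mul_self hs hg, smul_smul, inv_mul_cancel₀ (by norm_num),
      one_smul]
  inv_val := by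
    rw [Matrix.smul_mul, reflMatrix_mul_self hs hg, smul_smul, inv_mul_cancel₀ (by norm_num),
      one_smul]

/-- The first involution. -/
def refl₁ : GL3 K := reflUnit D.hs D.golden

/-- The second involution. -/
def refl₂ : GL3 K := reflUnit (s := -1 - D.s) (by linear_combination D.hs) D.golden

lemma reflUnit_mem {s g : K} (hs : 3 * s ^ 2 + 3 * s + 2 = 0) (hg : g ^ 2 + g - 1 = 0) :
    reflUnit hs hg ∈ wimanStabilizer K := by
  refine ⟨125, by norm_num, fun v => ?_⟩
  rw [← wimanVal_reflection hs hg]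
  congr 1 <;> simp [reflUnit, reflMatrix, Matrix.mulVec, dotProduct, Fin.sum_univ_three]

lemma refl₁_mem : D.refl₁ ∈ wimanStabilizer K := reflUnit_mem _ _

lemma refl₂_mem : D.refl₂ ∈ wimanStabilizer K := reflUnit_mem _ _

end WimanData

lemma IsCubeLine.eq_rotate_of_mul_eq [CharZero K] {a b A B D a' b' A' B' D' : K}
    (h : IsCubeLine a b A B D) (h' : IsCubeLine a' b' A' B' D') (hab : a * b = a' * b')
    (ht : 9 * (a * b) ^ 2 - 12 * (a * b) - 1 = 0) {ζ : K}
    (hζ : 1 + ζ + ζ ^ 2 + ζ ^ 3 + ζ ^ 4 = 0) :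
    ∃ η : K, η ^ 5 = 1 ∧ ((a = a' * η ∧ b = b' * η ^ 4) ∨ (a = b' * η ∧ b = a' * η ^ 4)) := by
  have e := h.exceptional ht
  have e' := h'.exceptional (by rw [← hab]; exact ht)
  have hsplit : (18 * (a * b) - 15) * ((a ^ 5 - a' ^ 5) * (a ^ 5 - b' ^ 5)) = 0 := by
    rw [← hab] at e'
    have h5 : a' ^ 5 * b' ^ 5 = a ^ 5 * b ^ 5 := by rw [← mul_pow, ← mul_pow, hab]
    linear_combination a ^ 5 * e - a ^ 5 * e' + (18 * (a * b) - 15) * h5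
  have ht' : 18 * (a * b) - 15 ≠ 0 := by
    intro h0
    generalize a * b = t at *
    have : (19 : K) = 0 := by linear_combination -4 * ht + (2 * t - 1) * h0
    norm_num at this
  have ha : a ≠ 0 := by rintro rfl; norm_num at ht
  have hζ5 : ζ ^ 5 = 1 := by linear_combination (ζ - 1) * hζ
  rcases mul_eq_zero.1 ((mul_eq_zero.1 hsplit).resolve_left ht') with h0 | h0
  · obtain ⟨i, hi⟩ := exists_fifth_root_of_unity_mul hζ (sub_eq_zero.1 h0)
    have hη : (ζ ^ (i : ℕ)) ^ 5 = 1 := by rw [← pow_mul, mul_comm, pow_mul, hζ5, one_pow]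
    refine ⟨ζ ^ (i : ℕ), hη, Or.inl ⟨hi, mul_left_cancel₀ ha ?_⟩⟩
    generalize ζ ^ (i : ℕ) = η at *
    linear_combination hab - b' * η ^ 4 * hi - a' * b' * hη
  · obtain ⟨i, hi⟩ := exists_fifth_root_of_unity_mul hζ (sub_eq_zero.1 h0)
    have hη : (ζ ^ (i : ℕ)) ^ 5 = 1 := by rw [← pow_mul, mul_comm, pow_mul, hζ5, one_pow]
    refine ⟨ζ ^ (i : ℕ), hη, Or.inr ⟨hi, mul_left_cancel₀ ha ?_⟩⟩
    generalize ζ ^ (i : ℕ) = η at *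
    linear_combination hab - a' * η ^ 4 * hi - a' * b' * hη

lemma fst_ne_zero_of_mem [IsAlgClosed K] [CharZero K] {A : GL3 K} (hA : A ∈ wimanStabilizer K) :
    A.1 0 0 ≠ 0 := by
  intro h0
  have h := isCubeRow_of_mem hA
  rw [h0] at h
  obtain ⟨h1, h2⟩ := h.eq_zero_of_fst_eq_zero
  have := congrFun (congrFun A.mul_inv 0) 0
  rw [Matrix.mul_apply, Fin.sum_univ_three, h0, h1, h2] at this
  simp at this

namespace WimanData

variable (D : WimanData K)

lemma rot_pow_val (n : ℕ) :
    (D.rot ^ n).1 = !![1, 0, 0; 0, D.ζ ^ n, 0; 0, 0, (D.ζ ^ n) ^ 4] := by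
  induction n with
  | zero => ext i j; fin_cases i <;> fin_cases j <;> simp
  | succ n ih =>
    rw [pow_succ, Units.val_mul, ih]
    ext i j; fin_cases i <;> fin_cases j <;>
      simp [rot, Matrix.mul_apply, Fin.sum_univ_three] <;> ring

variable [CharZero K]

/-- Representatives of the nontrivial orbits of the diagonal rotations on the tangent
conditions `IsCubeRow`. -/
def rep : Fin 5 ⊕ Fin 2 → GL3 K :=
  Sum.elim (fun k => D.refl₁ * D.rot ^ (k : ℕ) * D.refl₂) ![D.refl₁, D.refl₂]

lemma rep_mem (i : Fin 5 ⊕ Fin 2) : D.rep i ∈ wimanStabilizer K := by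
  rcases i with k | i
  · exact mul_mem (mul_mem D.refl₁_mem (pow_mem D.rot_mem _)) D.refl₂_mem
  · fin_cases i
    exacts [D.refl₁_mem, D.refl₂_mem]

/-- The line `x = a y + b z` is obtained from the first row of `rep i` by a rotation. -/
def IsRepLine (i : Fin 5 ⊕ Fin 2) (a b : K) : Prop :=
  ∃ η : K, η ^ 5 = 1 ∧ (D.rep i).1 0 0 * a = -(D.rep i).1 0 1 * η ∧
    (D.rep i).1 0 0 * b = -(D.rep i).1 0 2 * η ^ 4

lemma rep_inl_row (k : Fin 5) :
    (D.rep (.inl k)).1 0 0 = 1 + 3 * D.s ^ 2 * (D.ζ ^ (k : ℕ) + (D.ζ ^ (k : ℕ)) ^ 4) ∧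
    (D.rep (.inl k)).1 0 1 = -1 - D.s + D.s * (D.ζ ^ (k : ℕ) * (-1 - (D.ζ + D.ζ ^ 4))
      + (D.ζ ^ (k : ℕ)) ^ 4 * (D.ζ + D.ζ ^ 4)) ∧
    (D.rep (.inl k)).1 0 2 = -1 - D.s + D.s * (D.ζ ^ (k : ℕ) * (D.ζ + D.ζ ^ 4)
      + (D.ζ ^ (k : ℕ)) ^ 4 * (-1 - (D.ζ + D.ζ ^ 4))) := by
  simp only [rep, Sum.elim_inl, Units.val_mul, rot_pow_val]
  refine ⟨?_, ?_, ?_⟩ <;>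
    simp [refl₁, refl₂, reflUnit, reflMatrix, Matrix.mul_apply, Fin.sum_univ_three] <;> ring

lemma isRepLine_symmetric {a η : K} (hη : η ^ 5 = 1)
    (ha : (3 * a + 1) * (3 * a ^ 2 - 3 * a + 2) = 0) :
    ∃ i, D.IsRepLine i (a * η) (a * η ^ 4) := by
  have hfac : (3 * a + 1) * (a + D.s) * (a - 1 - D.s) = 0 := by
    linear_combination ha / 3 - (3 * a + 1) / 3 * D.hs
  rcases mul_eq_zero.1 hfac with h0 | h0
  · rcases mul_eq_zero.1 h0 with h0 | h0
    · refine ⟨.inl 0, η, hη, ?_⟩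
      obtain ⟨r0, r1, r2⟩ := D.rep_inl_row 0
      rw [r0, r1, r2]
      simp only [Fin.val_zero, pow_zero, one_pow]
      constructor
      · linear_combination η * ((1 + 6 * D.s ^ 2) / 3 * h0 - 2 / 3 * D.hs)
      · linear_combination η ^ 4 * ((1 + 6 * D.s ^ 2) / 3 * h0 - 2 / 3 * D.hs)
    · refine ⟨.inr 0, η, hη, ?_⟩
      constructor <;> simp only [rep, refl₁, reflUnit, reflMatrix, Sum.elim_inr,
        Matrix.of_apply, Matrix.cons_val]
      · linear_combination η * h0
      · linear_combination η ^ 4 * h0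
  · refine ⟨.inr 1, η, hη, ?_⟩
    constructor <;> simp only [rep, refl₂, reflUnit, reflMatrix, Sum.elim_inr,
      Matrix.of_apply, Matrix.cons_val]
    · linear_combination η * h0
    · linear_combination η ^ 4 * h0

lemma rep_inl_mul (k : Fin 5) (hu : 1 + D.ζ ^ (k : ℕ) + (D.ζ ^ (k : ℕ)) ^ 2
      + (D.ζ ^ (k : ℕ)) ^ 3 + (D.ζ ^ (k : ℕ)) ^ 4 = 0) :
    (D.rep (.inl k)).1 0 1 * (D.rep (.inl k)).1 0 2
      = (1 + 2 * (D.ζ ^ (k : ℕ) + (D.ζ ^ (k : ℕ)) ^ 4) / 3) * (D.rep (.inl k)).1 0 0 ^ 2 := by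
  obtain ⟨r0, r1, r2⟩ := D.rep_inl_row k
  rw [r0, r1, r2]
  have hg := D.golden
  have hs := D.hs
  generalize D.ζ ^ (k : ℕ) = u at *
  generalize D.ζ + D.ζ ^ 4 = g at *
  generalize D.s = s at *
  linear_combination (-6 * s ^ 4 * u ^ 8 + 6 * s ^ 4 * u ^ 7 - 18 * s ^ 4 * u ^ 5
    - g * s ^ 2 * u ^ 4 - g ^ 2 * s ^ 2 * u ^ 4 - 4 * s ^ 2 * u ^ 4 + 9 * s ^ 4 * u ^ 4
    + 3 * s ^ 4 * u ^ 3 + g * s ^ 2 * u ^ 3 + g ^ 2 * s ^ 2 * u ^ 3 + 4 * s ^ 2 * u ^ 3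
    - 12 * s ^ 4 * u ^ 2 - 7 * s ^ 2 * u + 2 * g * s ^ 2 * u + 2 * g ^ 2 * s ^ 2 * u + s
    + 2 * s ^ 2 - 2 / 3 - 2 * g * s ^ 2 - 2 * g ^ 2 * s ^ 2) * hu
    + (-s ^ 2 * u ^ 2 - s ^ 2 * u ^ 3 + 2 * s ^ 2) * hg
    + (s ^ 2 * u ^ 3 + s ^ 2 * u ^ 2 - s * u ^ 3 - s * u ^ 2 + 1 / 3 + 1 / 3 * u ^ 3
    + 1 / 3 * u ^ 2) * hs

lemma isRepLine_exceptional [IsAlgClosed K] {a b A B E : K} (h : IsCubeLine a b A B E)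
    (k k' : Fin 5) (hu : 1 + D.ζ ^ (k : ℕ) + (D.ζ ^ (k : ℕ)) ^ 2
      + (D.ζ ^ (k : ℕ)) ^ 3 + (D.ζ ^ (k : ℕ)) ^ 4 = 0)
    (hk : D.ζ ^ (k : ℕ) = (D.ζ ^ (k' : ℕ)) ^ 4) (hk' : D.ζ ^ (k' : ℕ) = (D.ζ ^ (k : ℕ)) ^ 4)
    (hab : a * b = 1 + 2 * (D.ζ ^ (k : ℕ) + (D.ζ ^ (k : ℕ)) ^ 4) / 3) :
    ∃ i, D.IsRepLine i a b := by
  have hα := fst_ne_zero_of_mem (D.rep_mem (.inl k))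
  obtain ⟨A', B', E', h'⟩ := (isCubeRow_of_mem (D.rep_mem (.inl k))).exists_isCubeLine hα
  have hm := D.rep_inl_mul k hu
  obtain ⟨η, hη, ⟨h1, h2⟩ | ⟨h1, h2⟩⟩ := h.eq_rotate_of_mul_eq h'
    (by rw [hab]; field_simp; linear_combination -3 * hm)
    (by
      rw [hab]
      generalize D.ζ ^ (k : ℕ) = u at *
      linear_combination (4 * u ^ 4 - 4 * u ^ 3 + 8 * u - 4) * hu) D.hζ
  · refine ⟨.inl k, η, hη, ?_, ?_⟩
    · rw [h1]; field_simp
    · rw [h2]; field_simp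
  · obtain ⟨r0, r1, r2⟩ := D.rep_inl_row k
    obtain ⟨s0, s1, s2⟩ := D.rep_inl_row k'
    have e0 : (D.rep (.inl k')).1 0 0 = (D.rep (.inl k)).1 0 0 := by
      rw [r0, s0, ← hk, ← hk', add_comm (D.ζ ^ (k : ℕ))]
    have e1 : (D.rep (.inl k')).1 0 1 = (D.rep (.inl k)).1 0 2 := by
      rw [s1, r2, ← hk, ← hk']; ring
    have e2 : (D.rep (.inl k')).1 0 2 = (D.rep (.inl k)).1 0 1 := by
      rw [s2, r1, ← hk, ← hk']; ring
    refine ⟨.inl k', η, hη, ?_, ?_⟩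
    · rw [h1, e0, e1]; field_simp
    · rw [h2, e0, e2]; field_simp

lemma eq_zero_or_isRepLine [IsAlgClosed K] {a b A B E : K} (h : IsCubeLine a b A B E) :
    (a = 0 ∧ b = 0) ∨ ∃ i, D.IsRepLine i a b := by
  rcases eq_or_ne a 0 with rfl | ha
  · exact Or.inl ⟨rfl, h.ne_zero⟩
  rcases eq_or_ne b 0 with rfl | hb
  · exact absurd h.swap.ne_zero ha
  right
  have hζ := D.hζ
  by_cases ht : 9 * (a * b) ^ 2 - 12 * (a * b) - 1 = 0
  · have hfac : (a * b - (1 + 2 * (D.ζ + D.ζ ^ 4) / 3))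
        * (a * b - (1 + 2 * (D.ζ ^ 2 + (D.ζ ^ 2) ^ 4) / 3)) = 0 := by
      linear_combination ht / 9 + (4 / 9 * D.ζ ^ 8 - 4 / 9 * D.ζ ^ 7 + 4 / 9 * D.ζ ^ 5
        - 2 / 3 * (a * b) * D.ζ ^ 4 + 2 / 9 * D.ζ ^ 4 + 2 / 3 * (a * b) * D.ζ ^ 3
        - 2 / 9 * D.ζ ^ 3 - 4 / 9 * D.ζ + 10 / 9 - 2 / 3 * (a * b)) * hζ
    rcases mul_eq_zero.1 hfac with h0 | h0
    · apply D.isRepLine_exceptional h 1 4 <;> simp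
      · exact hζ
      · linear_combination (-D.ζ ^ 12 + D.ζ ^ 11 - D.ζ ^ 7 + D.ζ ^ 6 - D.ζ ^ 2 + D.ζ) * hζ
      · linear_combination h0
    · apply D.isRepLine_exceptional h 2 3 <;> simp
      · linear_combination (D.ζ ^ 4 - D.ζ ^ 3 + D.ζ ^ 2 - D.ζ + 1) * hζ
      · linear_combination (-D.ζ ^ 8 + D.ζ ^ 7 - D.ζ ^ 3 + D.ζ ^ 2) * D.hζ
      · linear_combination (-D.ζ ^ 4 + D.ζ ^ 3) * D.hζ
      · linear_combination h0
  · obtain ⟨hAD, h5⟩ := h.dichotomy ha hb ht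
    obtain ⟨i, hi⟩ := exists_fifth_root_of_unity_mul hζ h5.symm
    have hη : (D.ζ ^ (i : ℕ)) ^ 5 = 1 := by
      rw [← pow_mul, mul_comm, pow_mul, D.ζ_pow_five, one_pow]
    generalize D.ζ ^ (i : ℕ) = η at *
    have hη0 : η ≠ 0 := by rintro rfl; simp at hη
    subst hi
    have hr := h.rotate (η := η ^ 3) (by linear_combination (η ^ 10 + η ^ 5 + 1) * hη)
    have hb' : a * η * (η ^ 3) ^ 4 = a * η ^ 3 := by
      linear_combination a * η ^ 3 * (η ^ 5 + 1) * hη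
    have hE : E = η ^ 2 * A := mul_left_cancel₀ (pow_ne_zero 2 ha) (by linear_combination hAD)
    rw [hb'] at hr
    obtain ⟨j, hj⟩ := D.isRepLine_symmetric (η := η ^ 2)
      (by linear_combination (η ^ 5 + 1) * hη)
      (hr.symmetric (mul_ne_zero ha (pow_ne_zero 3 hη0))
        (by rw [hE]; linear_combination -A * η * (η ^ 5) * hη))
    refine ⟨j, ?_⟩
    convert hj using 1
    · linear_combination -a * hη
    · linear_combination -a * η * (η ^ 5 + 1) * hη

end WimanData

lemma row_mul_inv_eq {A B : GL3 K} {μ : K} (h : ∀ j, A.1 0 j = μ * B.1 0 j) :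
    ∀ j, (A * B⁻¹).1 0 j = μ * (1 : Matrix (Fin 3) (Fin 3) K) 0 j := by
  intro j
  have hB : (B * B⁻¹).1 = 1 := by rw [mul_inv_cancel]; rfl
  rw [← hB, Units.val_mul, Units.val_mul, Matrix.mul_apply, Matrix.mul_apply, Finset.mul_sum]
  exact Finset.sum_congr rfl fun i _ => by rw [h, mul_assoc]

namespace WimanData

variable (D : WimanData K)

/-- An automorphism fixing the line `X = 0` is diagonal, up to `flip`. -/
lemma exists_eq_smul_of_row [CharZero K] {A : GL3 K} (hA : A ∈ wimanStabilizer K) {μ : K}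
    (hμ : μ ≠ 0) (h : ∀ j, A.1 0 j = μ * (1 : Matrix (Fin 3) (Fin 3) K) 0 j) :
    ∃ (i : Fin 5) (j : Fin 2), A.1 = μ • (D.rot ^ (i : ℕ) * D.flip ^ (j : ℕ)).1 := by
  obtain ⟨c, hc, hA⟩ := hA
  have h00 := h 0
  have h01 := h 1
  have h02 := h 2
  simp at h00 h01 h02
  have hdet : A.1.det ≠ 0 := ((Matrix.isUnit_iff_isUnit_det _).1 A.isUnit).ne_zero
  rw [Matrix.det_fin_three, h00, h01, h02] at hdet
  have key := eq_of_wimanVal_linear (p := A.1 1 0 / μ) (q := A.1 1 1 / μ) (r := A.1 1 2 / μ)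
    (p' := A.1 2 0 / μ) (q' := A.1 2 1 / μ) (r' := A.1 2 2 / μ) (c := c / μ ^ 6)
    (by
      intro h0
      apply hdet
      field_simp at h0
      linear_combination μ * h0)
    (fun x y z => by
      have := hA ![x, y, z]
      simp only [Matrix.mulVec, dotProduct, Fin.sum_univ_three, Matrix.cons_val, h00, h01, h02]
        at this
      rw [div_mul_eq_mul_div c, ← this, wimanVal, wimanVal]
      field_simp
      ring)
  obtain ⟨h10, h20, ⟨h12, h21, h5, h22⟩ | ⟨h11, h22, h5, h21⟩⟩ := key
  · obtain ⟨i, hi⟩ := exists_fifth_root_of_unity_mul D.hζ (h5.trans (one_pow 5).symm)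
    refine ⟨i, 0, ?_⟩
    rw [one_mul] at hi
    rw [Fin.val_zero, pow_zero, mul_one, rot_pow_val, ← hi]
    ext k l; fin_cases k <;> fin_cases l <;> simp [h00, h01, h02] <;> field_simp at * <;> simp [*]
  · obtain ⟨i, hi⟩ := exists_fifth_root_of_unity_mul D.hζ (h5.trans (one_pow 5).symm)
    refine ⟨i, 1, ?_⟩
    rw [one_mul] at hi
    rw [Fin.val_one, pow_one, Units.val_mul, rot_pow_val, ← hi]
    ext k l; fin_cases k <;> fin_cases l <;> simp [flip, h00, h01,
      h02] <;> field_simp at * <;> simp [*]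

variable [CharZero K]

/-- Representatives of the cosets of the automorphisms fixing the line `X = 0`. -/
def cosetRep : Option ((Fin 5 ⊕ Fin 2) × Fin 5) → GL3 K
  | none => 1
  | some (i, j) => D.rep i * D.rot ^ (j : ℕ)

lemma cosetRep_mem : ∀ w, D.cosetRep w ∈ wimanStabilizer K
  | none => one_mem _
  | some (i, _) => mul_mem (D.rep_mem i) (pow_mem D.rot_mem _)

lemma exists_row_eq [IsAlgClosed K] {A : GL3 K} (hA : A ∈ wimanStabilizer K) :
    ∃ w, ∃ μ : K, μ ≠ 0 ∧ ∀ j, A.1 0 j = μ * (D.cosetRep w).1 0 j := by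
  have hα := fst_ne_zero_of_mem hA
  obtain ⟨A', B', E', h⟩ := (isCubeRow_of_mem hA).exists_isCubeLine hα
  rcases D.eq_zero_or_isRepLine h with ⟨h1, h2⟩ | ⟨i, η, hη, h1, h2⟩
  · refine ⟨none, A.1 0 0, hα, fun j => ?_⟩
    simp [hα] at h1 h2
    fin_cases j <;> simp [cosetRep, h1, h2]
  · have hr := fst_ne_zero_of_mem (D.rep_mem i)
    obtain ⟨j, hj⟩ := exists_fifth_root_of_unity_mul D.hζ (hη.trans (one_pow 5).symm)
    rw [one_mul] at hj
    refine ⟨some (i, j), A.1 0 0 / (D.rep i).1 0 0, div_ne_zero hα hr, fun l => ?_⟩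
    rw [cosetRep, Units.val_mul, rot_pow_val, ← hj, Matrix.mul_apply, Fin.sum_univ_three]
    field_simp at h1 h2
    fin_cases l <;> simp <;> field_simp
    · linear_combination -h1
    · linear_combination -h2

/-- A list of matrices representing all automorphisms. -/
def word (x : (Fin 5 × Fin 2) × Option ((Fin 5 ⊕ Fin 2) × Fin 5)) : GL3 K :=
  D.rot ^ (x.1.1 : ℕ) * D.flip ^ (x.1.2 : ℕ) * D.cosetRep x.2

lemma exists_eq_smul_word [IsAlgClosed K] {A : GL3 K} (hA : A ∈ wimanStabilizer K) :
    ∃ x, ∃ μ : K, μ ≠ 0 ∧ A.1 = μ • (D.word x).1 := by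
  obtain ⟨w, μ, hμ, h⟩ := D.exists_row_eq hA
  obtain ⟨i, j, h'⟩ := D.exists_eq_smul_of_row (mul_mem hA (inv_mem (D.cosetRep_mem w))) hμ
    (row_mul_inv_eq h)
  refine ⟨((i, j), w), μ, hμ, ?_⟩
  rw [word, Units.val_mul _ (D.cosetRep w), ← Matrix.smul_mul, ← h', ← Units.val_mul,
    inv_mul_cancel_right]

end WimanData

lemma mk_eq_mk_of_smul {A B : GL3 K} {μ : K} (h : A.1 = μ • B.1) :
    (QuotientGroup.mk A : PGL3 K) = QuotientGroup.mk B := by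
  refine (QuotientGroup.eq.2 ?_).symm
  rw [Subgroup.mem_center_iff]
  have h1 : (B⁻¹ * A).1 = μ • 1 := by
    rw [Units.val_mul, h, Matrix.mul_smul, ← Units.val_mul, inv_mul_cancel, Units.val_one]
  intro C
  ext1
  rw [Units.val_mul, Units.val_mul (B⁻¹ * A), h1, Matrix.mul_smul, Matrix.smul_mul, mul_one,
    one_mul]

lemma mem_planeAut_wimanSextic [CharZero K] {g : PGL3 K} :
    g ∈ planeAut (wimanSextic K) ↔ ∃ A ∈ wimanStabilizer K, (QuotientGroup.mk A : PGL3 K) = g := by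
  simp only [mem_wimanStabilizer_iff_matAct]
  exact exists_congr fun A => and_comm

lemma finite_planeAut_and_card_le [IsAlgClosed K] [CharZero K] :
    Finite (planeAut (wimanSextic K)) ∧ Nat.card (planeAut (wimanSextic K)) ≤ 360 := by
  obtain ⟨D⟩ := nonempty_wimanData (K := K)
  have hsub : (planeAut (wimanSextic K) : Set (PGL3 K))
      ⊆ Set.range fun x => (QuotientGroup.mk (D.word x) : PGL3 K) := by
    intro g hg
    obtain ⟨A, hA, rfl⟩ := mem_planeAut_wimanSextic.1 hg
    obtain ⟨x, μ, hμ, h⟩ := D.exists_eq_smul_word hA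
    exact ⟨x, (mk_eq_mk_of_smul h).symm⟩
  refine ⟨(Set.finite_range _).subset hsub, ?_⟩
  calc Nat.card (planeAut (wimanSextic K))
    _ ≤ (Set.range fun x => (QuotientGroup.mk (D.word x) : PGL3 K)).ncard :=
        Set.ncard_le_ncard hsub (Set.finite_range _)
    _ ≤ 360 := by
        rw [← Set.image_univ]
        refine (Set.ncard_image_le Set.finite_univ).trans ?_
        rw [Set.ncard_univ, Nat.card_eq_fintype_card]
        simp

/-- The conic stabilised by the diagonal rotations. -/
def baseConic (s x y z : K) : K := 3 * x ^ 2 - (3 * s + 2) * y * z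

/-- The other conics of the configuration of six conics attached to the Wiman sextic. -/
def conicForm (s u v x y z : K) : K :=
  6 * x ^ 2 + (6 + 9 * s) * x * (u * y + v * z) - 3 * s * (u ^ 2 * y ^ 2 + v ^ 2 * z ^ 2)
    + (2 + 3 * s) * y * z

lemma conic_refl₁_zero {ζ s : K} (hζ : 1 + ζ + ζ ^ 2 + ζ ^ 3 + ζ ^ 4 = 0)
    (hs : 3 * s ^ 2 + 3 * s + 2 = 0) (x y z : K) :
    baseConic s (x + s * y + s * z) (-(3 * s + 3) * x + (-1 - (ζ + ζ ^ 4)) * y + (ζ + ζ ^ 4) * z)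
      (-(3 * s + 3) * x + (ζ + ζ ^ 4) * y + (-1 - (ζ + ζ ^ 4)) * z)
      = 5 * baseConic s x y z := by
  simp only [baseConic]
  linear_combination (3 * s * y ^ 2 * ζ ^ 4 - 6 * s * y * z * ζ ^ 4 + 3 * s * z ^ 2 * ζ ^ 4 + 2
    * y ^ 2 * ζ ^ 4 - 4 * y * z * ζ ^ 4 + 2 * z ^ 2 * ζ ^ 4 - 3 * s * y ^ 2 * ζ ^ 3 + 6 * s * y *
    z * ζ ^ 3 - 3 * s * z ^ 2 * ζ ^ 3 - 2 * y ^ 2 * ζ ^ 3 + 4 * y * z * ζ ^ 3 - 2 * z ^ 2 * ζ ^ 3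
    + 6 * s * y ^ 2 * ζ - 12 * s * y * z * ζ + 6 * s * z ^ 2 * ζ + 4 * y ^ 2 * ζ - 8 * y * z * ζ +
    4 * z ^ 2 * ζ - 3 * s * y ^ 2 + 6 * s * y * z - 3 * s * z ^ 2 - 2 * y ^ 2 + 4 * y * z - 2 * z
    ^ 2) * hζ + (-9 * s * x ^ 2 + y ^ 2 + 2 * y * z + z ^ 2 - 15 * x ^ 2 - 3 * x * z - 3 * x * y)
    * hs

lemma conic_refl₁_one {ζ s : K} (hζ : 1 + ζ + ζ ^ 2 + ζ ^ 3 + ζ ^ 4 = 0)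
    (hs : 3 * s ^ 2 + 3 * s + 2 = 0) (x y z : K) :
    conicForm s 1 1 (x + s * y + s * z) (-(3 * s + 3) * x + (-1 - (ζ + ζ ^ 4)) * y +
      (ζ + ζ ^ 4) * z)
      (-(3 * s + 3) * x + (ζ + ζ ^ 4) * y + (-1 - (ζ + ζ ^ 4)) * z)
      = 5 * conicForm s 1 1 x y z := by
  simp only [conicForm]
  linear_combination (-9 * s * y ^ 2 * ζ ^ 4 + 18 * s * y * z * ζ ^ 4 - 9 * s * z ^ 2 * ζ ^ 4 -
    2 * y ^ 2 * ζ ^ 4 + 4 * y * z * ζ ^ 4 - 2 * z ^ 2 * ζ ^ 4 + 9 * s * y ^ 2 * ζ ^ 3 - 18 * s * y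
    * z * ζ ^ 3 + 9 * s * z ^ 2 * ζ ^ 3 + 2 * y ^ 2 * ζ ^ 3 - 4 * y * z * ζ ^ 3 + 2 * z ^ 2 * ζ ^
    3 - 18 * s * y ^ 2 * ζ + 36 * s * y * z * ζ - 18 * s * z ^ 2 * ζ - 4 * y ^ 2 * ζ + 8 * y * z *
    ζ - 4 * z ^ 2 * ζ + 9 * s * y ^ 2 - 18 * s * y * z + 9 * s * z ^ 2 + 2 * y ^ 2 - 4 * y * z + 2
    * z ^ 2) * hζ + (-18 * s * x * y - 18 * s * x * z - 9 * s * x ^ 2 - y ^ 2 - 2 * y * z - z ^ 2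
    - 21 * x ^ 2 - 15 * x * y - 15 * x * z) * hs

lemma conic_refl₁_two {ζ s : K} (hζ : 1 + ζ + ζ ^ 2 + ζ ^ 3 + ζ ^ 4 = 0)
    (hs : 3 * s ^ 2 + 3 * s + 2 = 0) (x y z : K) :
    conicForm s (ζ ^ 2) (ζ ^ 3) (x + s * y + s * z) (-(3 * s + 3) * x + (-1 - (ζ + ζ ^ 4)) * y +
      (ζ + ζ ^ 4) * z)
      (-(3 * s + 3) * x + (ζ + ζ ^ 4) * y + (-1 - (ζ + ζ ^ 4)) * z)
      = (-4 - 3 * ζ ^ 2 - 3 * ζ ^ 3 - 3 * s - 6 * s * ζ ^ 2 - 6 * s * ζ ^ 3) * conicForm s ζ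
        (ζ ^ 4) x y z := by
  simp only [conicForm]
  linear_combination (-3 * s * y ^ 2 * ζ ^ 10 + 6 * s * y * z * ζ ^ 10 - 3 * s * z ^ 2 * ζ ^ 10
    + 3 * s * y ^ 2 * ζ ^ 9 - 6 * s * y * z * ζ ^ 9 + 3 * s * z ^ 2 * ζ ^ 9 - 3 * s * y ^ 2 * ζ ^
    8 + 6 * s * y * z * ζ ^ 8 - 3 * s * z ^ 2 * ζ ^ 8 - 3 * s * y ^ 2 * ζ ^ 7 + 6 * s * y * z * ζ
    ^ 7 - 12 * s * z ^ 2 * ζ ^ 7 - 18 * s ^ 2 * z ^ 2 * ζ ^ 7 + 18 * s ^ 2 * x * y * ζ ^ 6 - 18 *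
    s ^ 2 * x * z * ζ ^ 6 + 18 * s * x * y * ζ ^ 6 - 18 * s * x * z * ζ ^ 6 + 6 * s * y ^ 2 * ζ ^
    6 - 6 * s * y * z * ζ ^ 6 - 9 * s * y ^ 2 * ζ ^ 5 + 12 * s * y * z * ζ ^ 5 + 6 * s * z ^ 2 * ζ
    ^ 5 + 18 * s ^ 2 * z ^ 2 * ζ ^ 5 - 18 * s ^ 2 * x * y * ζ ^ 5 + 18 * s ^ 2 * x * z * ζ ^ 5 -
    18 * s * x * y * ζ ^ 5 + 18 * s * x * z * ζ ^ 5 - 18 * s ^ 2 * x * y * ζ ^ 4 + 18 * s ^ 2 * x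
    * z * ζ ^ 4 - 18 * s * x * y * ζ ^ 4 + 18 * s * x * z * ζ ^ 4 - 3 * s * y ^ 2 * ζ ^ 4 - 9 * s
    * z ^ 2 * ζ ^ 4 - 2 * y ^ 2 * ζ ^ 4 + 4 * y * z * ζ ^ 4 - 2 * z ^ 2 * ζ ^ 4 - 9 * s ^ 2 * z ^
    2 * ζ ^ 4 + 45 * s * x * y * ζ ^ 3 + 18 * s * x * z * ζ ^ 3 + 9 * s ^ 2 * y ^ 2 * ζ ^ 3 + 6 *
    x * y * ζ ^ 3 + 12 * x * z * ζ ^ 3 + 15 * s * y ^ 2 * ζ ^ 3 + 18 * s ^ 2 * x * z * ζ ^ 3 - 6 *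
    s * y * z * ζ ^ 3 + 3 * s * z ^ 2 * ζ ^ 3 + 36 * s ^ 2 * x * y * ζ ^ 3 + 2 * y ^ 2 * ζ ^ 3 - 4
    * y * z * ζ ^ 3 + 2 * z ^ 2 * ζ ^ 3 - 36 * s * x * y * ζ ^ 2 + 18 * s * x * z * ζ ^ 2 - 18 * s
    ^ 2 * y ^ 2 * ζ ^ 2 - 12 * x * y * ζ ^ 2 + 12 * x * z * ζ ^ 2 - 18 * s * y ^ 2 * ζ ^ 2 - 27 *
    s ^ 3 * x ^ 2 * ζ ^ 2 - 54 * s ^ 2 * x ^ 2 * ζ ^ 2 - 27 * s * x ^ 2 * ζ ^ 2 - 18 * s ^ 2 * x *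
    y * ζ ^ 2 + 6 * s * y * z * ζ ^ 2 - 6 * s * y ^ 2 * ζ + 6 * s * y * z * ζ - 6 * s * z ^ 2 * ζ
    - 4 * y ^ 2 * ζ + 8 * y * z * ζ - 4 * z ^ 2 * ζ - 9 * s ^ 2 * y ^ 2 * ζ - 9 * s ^ 2 * z ^ 2 *
    ζ - 36 * s ^ 2 * x * z * ζ + 9 * s * x * y * ζ - 54 * s * x * z * ζ + 6 * x * y * ζ - 24 * x *
    z * ζ + 27 * s ^ 3 * x ^ 2 * ζ + 54 * s ^ 2 * x ^ 2 * ζ + 27 * s * x ^ 2 * ζ + 54 * s * x * y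
    + 45 * s * x * z + 24 * x * y + 18 * x * z + 36 * s ^ 2 * x * y + 3 * s * y ^ 2 + 27 * s ^ 2 *
    x * z + 3 * s * z ^ 2 + 2 * y ^ 2 - 4 * y * z + 2 * z ^ 2 + 9 * s ^ 2 * y ^ 2 + 9 * s ^ 2 * z
    ^ 2 - 27 * s ^ 3 * x ^ 2 - 54 * s ^ 2 * x ^ 2 - 27 * s * x ^ 2) * hζ + (-9 * s * x * y * ζ ^ 2
    - 9 * s * x * y * ζ ^ 3 - 9 * s * x * z * ζ ^ 2 - 9 * s * x * z * ζ ^ 3 + 18 * s * x ^ 2 + 9 *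
    s * x ^ 2 * ζ ^ 3 + 9 * s * x ^ 2 * ζ ^ 2 - y ^ 2 + 7 * y * z - z ^ 2 - 12 * x * y * ζ ^ 2 - 6
    * x * y * ζ ^ 3 - 3 * x * z * ζ ^ 2 + 3 * y * z * ζ ^ 2 + 3 * y * z * ζ ^ 3 - 9 * x * z * ζ ^
    3 + 24 * x ^ 2 - 6 * x * z - 9 * x * y - 3 * x * y * ζ + 3 * x * z * ζ) * hs

lemma conic_refl₁_three {ζ s : K} (hζ : 1 + ζ + ζ ^ 2 + ζ ^ 3 + ζ ^ 4 = 0)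
    (hs : 3 * s ^ 2 + 3 * s + 2 = 0) (x y z : K) :
    conicForm s ζ (ζ ^ 4) (x + s * y + s * z) (-(3 * s + 3) * x + (-1 - (ζ + ζ ^ 4)) * y +
      (ζ + ζ ^ 4) * z)
      (-(3 * s + 3) * x + (ζ + ζ ^ 4) * y + (-1 - (ζ + ζ ^ 4)) * z)
      = (3 * ζ ^ 2 - 1 + 3 * ζ ^ 3 + 3 * s + 6 * s * ζ ^ 2 + 6 * s * ζ ^ 3) * conicForm s (ζ ^ 2)
        (ζ ^ 3) x y z := by
  simp only [conicForm]
  linear_combination (-3 * s * y ^ 2 * ζ ^ 12 + 6 * s * y * z * ζ ^ 12 - 3 * s * z ^ 2 * ζ ^ 12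
    + 3 * s * y ^ 2 * ζ ^ 11 - 6 * s * y * z * ζ ^ 11 + 3 * s * z ^ 2 * ζ ^ 11 - 6 * s * y ^ 2 * ζ
    ^ 9 + 12 * s * y * z * ζ ^ 9 - 6 * s * z ^ 2 * ζ ^ 9 + 18 * s ^ 2 * x * y * ζ ^ 8 - 18 * s ^ 2
    * x * z * ζ ^ 8 + 18 * s * x * y * ζ ^ 8 - 18 * s * x * z * ζ ^ 8 - 6 * s * y * z * ζ ^ 8 + 6
    * s * y ^ 2 * ζ ^ 8 - 3 * s * y ^ 2 * ζ ^ 7 + 3 * s * z ^ 2 * ζ ^ 7 - 18 * s ^ 2 * x * y * ζ ^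
    7 + 18 * s ^ 2 * x * z * ζ ^ 7 - 18 * s * x * y * ζ ^ 7 + 18 * s * x * z * ζ ^ 7 + 6 * s * y *
    z * ζ ^ 6 - 3 * s * y ^ 2 * ζ ^ 6 - 3 * s * z ^ 2 * ζ ^ 6 + 9 * s * z ^ 2 * ζ ^ 5 + 18 * s ^ 2
    * z ^ 2 * ζ ^ 5 + 6 * s * y ^ 2 * ζ ^ 5 + 18 * s ^ 2 * x * y * ζ ^ 5 - 18 * s ^ 2 * x * z * ζ
    ^ 5 + 18 * s * x * y * ζ ^ 5 - 18 * s * x * z * ζ ^ 5 - 6 * s * y * z * ζ ^ 5 - 9 * s * x * y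
    * ζ ^ 4 - 9 * s * x * z * ζ ^ 4 + 9 * s ^ 2 * y ^ 2 * ζ ^ 4 - 9 * s ^ 2 * z ^ 2 * ζ ^ 4 + 6 *
    x * y * ζ ^ 4 - 6 * x * z * ζ ^ 4 - 12 * s * z ^ 2 * ζ ^ 4 - 27 * s ^ 3 * x ^ 2 * ζ ^ 4 - 54 *
    s ^ 2 * x ^ 2 * ζ ^ 4 - 27 * s * x ^ 2 * ζ ^ 4 + 12 * s * y * z * ζ ^ 4 - 2 * y ^ 2 * ζ ^ 4 +
    4 * y * z * ζ ^ 4 - 2 * z ^ 2 * ζ ^ 4 - 3 * s * y ^ 2 * ζ ^ 4 - 18 * s ^ 2 * x * y * ζ ^ 4 + 6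
    * s * y ^ 2 * ζ ^ 3 - 3 * s * z ^ 2 * ζ ^ 3 + 9 * s ^ 2 * y ^ 2 * ζ ^ 3 - 9 * s ^ 2 * z ^ 2 *
    ζ ^ 3 + 9 * s * x * y * ζ ^ 3 + 9 * s * x * z * ζ ^ 3 - 6 * x * y * ζ ^ 3 + 6 * x * z * ζ ^ 3
    + 27 * s ^ 3 * x ^ 2 * ζ ^ 3 + 54 * s ^ 2 * x ^ 2 * ζ ^ 3 + 27 * s * x ^ 2 * ζ ^ 3 + 2 * y ^ 2
    * ζ ^ 3 - 4 * y * z * ζ ^ 3 + 2 * z ^ 2 * ζ ^ 3 + 18 * s ^ 2 * x * y * ζ ^ 3 - 36 * s ^ 2 * x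
    * y * ζ ^ 2 - 18 * s ^ 2 * x * z * ζ ^ 2 - 36 * s * x * y * ζ ^ 2 - 27 * s * x * z * ζ ^ 2 -
    18 * x * z * ζ ^ 2 + 6 * s * z ^ 2 * ζ ^ 2 - 6 * s * y * z * ζ ^ 2 - 3 * s * y ^ 2 * ζ ^ 2 + 9
    * s ^ 2 * z ^ 2 * ζ ^ 2 - 12 * s * y ^ 2 * ζ + 12 * s * y * z * ζ - 4 * y ^ 2 * ζ + 8 * y * z
    * ζ - 4 * z ^ 2 * ζ - 18 * s * x * z * ζ - 45 * s * x * y * ζ - 18 * x * y * ζ - 18 * s ^ 2 *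
    x * z * ζ - 36 * s ^ 2 * x * y * ζ - 18 * s ^ 2 * y ^ 2 * ζ - 6 * s * z ^ 2 * ζ - 9 * s ^ 2 *
    z ^ 2 * ζ - 27 * s ^ 2 * x ^ 2 - 45 * s * x ^ 2 - 27 * s ^ 3 * x * y - 27 * s ^ 2 * x * y - 9
    * s ^ 2 * y * z - 27 * s ^ 3 * x * z - 9 * s ^ 2 * x * z - 18 * x ^ 2 + 3 * s * y ^ 2 + 3 * s
    * z ^ 2 + 9 * s ^ 2 * y ^ 2 + 12 * x * z + 2 * y ^ 2 - 4 * y * z + 2 * z ^ 2 - 12 * s * y * z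
    + 18 * s * x * z + 9 * s ^ 2 * z ^ 2) * hζ + (-9 * s * x ^ 2 * ζ ^ 2 + 9 * s * x ^ 2 - 9 * s *
    x ^ 2 * ζ ^ 3 + 9 * s * x * y * ζ ^ 3 + 9 * s * x * y * ζ ^ 2 + 9 * s * x * y + 9 * s * x * z
    * ζ ^ 3 + 9 * s * x * z * ζ ^ 2 + 9 * s * x * z - y ^ 2 + 4 * y * z - z ^ 2 + 6 * x * y * ζ -
    6 * x * z * ζ + 9 * x * y * ζ ^ 2 + 3 * x * z * ζ ^ 3 + 24 * x ^ 2 - 3 * x * z + 3 * x * y - 3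
    * y * z * ζ ^ 2 - 3 * y * z * ζ ^ 3 + 6 * x * z * ζ ^ 2 + 12 * x * y * ζ ^ 3) * hs

lemma conic_refl₂_zero [CharZero K] {ζ s : K} (hζ : 1 + ζ + ζ ^ 2 + ζ ^ 3 + ζ ^ 4 = 0)
    (hs : 3 * s ^ 2 + 3 * s + 2 = 0) (x y z : K) :
    conicForm s 1 1 (x + (-1 - s) * y + (-1 - s) * z)
      (-(3 * (-1 - s) + 3) * x + (-1 - (ζ + ζ ^ 4)) * y + (ζ + ζ ^ 4) * z)
      (-(3 * (-1 - s) + 3) * x + (ζ + ζ ^ 4) * y + (-1 - (ζ + ζ ^ 4)) * z)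
      = (-20 - 15 * s) * baseConic s x y z := by
  simp only [baseConic, conicForm]
  linear_combination (-9 * s * y ^ 2 * ζ ^ 4 + 18 * s * y * z * ζ ^ 4 - 9 * s * z ^ 2 * ζ ^ 4 -
    2 * y ^ 2 * ζ ^ 4 + 4 * y * z * ζ ^ 4 - 2 * z ^ 2 * ζ ^ 4 + 9 * s * y ^ 2 * ζ ^ 3 - 18 * s * y
    * z * ζ ^ 3 + 9 * s * z ^ 2 * ζ ^ 3 + 2 * y ^ 2 * ζ ^ 3 - 4 * y * z * ζ ^ 3 + 2 * z ^ 2 * ζ ^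
    3 - 18 * s * y ^ 2 * ζ + 36 * s * y * z * ζ - 18 * s * z ^ 2 * ζ - 4 * y ^ 2 * ζ + 8 * y * z *
    ζ - 4 * z ^ 2 * ζ + 9 * s * y ^ 2 - 18 * s * y * z + 9 * s * z ^ 2 + 2 * y ^ 2 - 4 * y * z + 2
    * z ^ 2) * hζ + (-18 * s * x * y - 18 * s * x * z - 9 * s * x ^ 2 + 5 * y ^ 2 - 5 * y * z + 5
    * z ^ 2 + 33 * x ^ 2 - 9 * x * y - 9 * x * z) * hs

lemma conic_refl₂_one [CharZero K] {ζ s : K} (hζ : 1 + ζ + ζ ^ 2 + ζ ^ 3 + ζ ^ 4 = 0)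
    (hs : 3 * s ^ 2 + 3 * s + 2 = 0) (x y z : K) :
    baseConic s (x + (-1 - s) * y + (-1 - s) * z)
      (-(3 * (-1 - s) + 3) * x + (-1 - (ζ + ζ ^ 4)) * y + (ζ + ζ ^ 4) * z)
      (-(3 * (-1 - s) + 3) * x + (ζ + ζ ^ 4) * y + (-1 - (ζ + ζ ^ 4)) * z)
      = (3 / 2 * s - 1 / 2) * conicForm s 1 1 x y z := by
  simp only [baseConic, conicForm]
  linear_combination (3 * s * y ^ 2 * ζ ^ 4 - 6 * s * y * z * ζ ^ 4 + 3 * s * z ^ 2 * ζ ^ 4 + 2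
    * y ^ 2 * ζ ^ 4 - 4 * y * z * ζ ^ 4 + 2 * z ^ 2 * ζ ^ 4 - 3 * s * y ^ 2 * ζ ^ 3 + 6 * s * y *
    z * ζ ^ 3 - 3 * s * z ^ 2 * ζ ^ 3 - 2 * y ^ 2 * ζ ^ 3 + 4 * y * z * ζ ^ 3 - 2 * z ^ 2 * ζ ^ 3
    + 6 * s * y ^ 2 * ζ - 12 * s * y * z * ζ + 6 * s * z ^ 2 * ζ + 4 * y ^ 2 * ζ - 8 * y * z * ζ +
    4 * z ^ 2 * ζ - 3 * s * y ^ 2 + 6 * s * y * z - 3 * s * z ^ 2 - 2 * y ^ 2 + 4 * y * z - 2 * z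
    ^ 2) * hζ + (-9 * s * x ^ 2 + 5 / 2 * y ^ 2 + 1 / 2 * y * z + 5 / 2 * z ^ 2 - 3 / 2 * x * z -
    3 / 2 * x * y + 3 * x ^ 2) * hs

lemma conic_refl₂_two [CharZero K] {ζ s : K} (hζ : 1 + ζ + ζ ^ 2 + ζ ^ 3 + ζ ^ 4 = 0)
    (hs : 3 * s ^ 2 + 3 * s + 2 = 0) (x y z : K) :
    conicForm s (ζ ^ 4) ζ (x + (-1 - s) * y + (-1 - s) * z)
      (-(3 * (-1 - s) + 3) * x + (-1 - (ζ + ζ ^ 4)) * y + (ζ + ζ ^ 4) * z)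
      (-(3 * (-1 - s) + 3) * x + (ζ + ζ ^ 4) * y + (-1 - (ζ + ζ ^ 4)) * z)
      = 5 * conicForm s ζ (ζ ^ 4) x y z := by
  simp only [conicForm]
  linear_combination (-3 * s * y ^ 2 * ζ ^ 12 + 6 * s * y * z * ζ ^ 12 - 3 * s * z ^ 2 * ζ ^ 12
    + 3 * s * y ^ 2 * ζ ^ 11 - 6 * s * y * z * ζ ^ 11 + 3 * s * z ^ 2 * ζ ^ 11 - 6 * s * y ^ 2 * ζ
    ^ 9 + 12 * s * y * z * ζ ^ 9 - 6 * s * z ^ 2 * ζ ^ 9 + 18 * s ^ 2 * x * y * ζ ^ 8 - 18 * s ^ 2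
    * x * z * ζ ^ 8 - 6 * s * y * z * ζ ^ 8 + 6 * s * z ^ 2 * ζ ^ 8 + 3 * s * y ^ 2 * ζ ^ 7 - 3 *
    s * z ^ 2 * ζ ^ 7 - 18 * s ^ 2 * x * y * ζ ^ 7 + 18 * s ^ 2 * x * z * ζ ^ 7 + 6 * s * y * z *
    ζ ^ 6 - 3 * s * z ^ 2 * ζ ^ 6 - 3 * s * y ^ 2 * ζ ^ 6 + 6 * s * z ^ 2 * ζ ^ 5 + 18 * s ^ 2 * x
    * y * ζ ^ 5 - 18 * s ^ 2 * x * z * ζ ^ 5 - 6 * s * y * z * ζ ^ 5 - 9 * s * x * y * ζ ^ 4 + 9 *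
    s * x * z * ζ ^ 4 + 9 * s * y ^ 2 * ζ ^ 4 + 9 * s ^ 2 * y ^ 2 * ζ ^ 4 - 9 * s * z ^ 2 * ζ ^ 4
    - 9 * s ^ 2 * z ^ 2 * ζ ^ 4 - 6 * x * y * ζ ^ 4 + 6 * x * z * ζ ^ 4 + 4 * y ^ 2 * ζ ^ 4 - 8 *
    z ^ 2 * ζ ^ 4 - 27 * s ^ 3 * x ^ 2 * ζ ^ 4 + 12 * s * y * z * ζ ^ 4 + 4 * y * z * ζ ^ 4 + 18 *
    s ^ 2 * x * z * ζ ^ 4 - 15 * s * y ^ 2 * ζ ^ 3 + 3 * s * z ^ 2 * ζ ^ 3 + 9 * s * x * y * ζ ^ 3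
    - 9 * s * x * z * ζ ^ 3 - 9 * s ^ 2 * y ^ 2 * ζ ^ 3 + 9 * s ^ 2 * z ^ 2 * ζ ^ 3 + 6 * x * y *
    ζ ^ 3 - 6 * x * z * ζ ^ 3 - 4 * y ^ 2 * ζ ^ 3 + 8 * z ^ 2 * ζ ^ 3 + 27 * s ^ 3 * x ^ 2 * ζ ^ 3
    - 4 * y * z * ζ ^ 3 - 18 * s ^ 2 * x * z * ζ ^ 3 - 36 * s ^ 2 * x * y * ζ ^ 2 + 36 * s ^ 2 * x
    * z * ζ ^ 2 + 9 * s * y ^ 2 * ζ ^ 2 - 6 * s * y * z * ζ ^ 2 - 3 * s * z ^ 2 * ζ ^ 2 + 12 * s *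
    y * z * ζ - 3 * s * z ^ 2 * ζ - 4 * y ^ 2 * ζ + 8 * y * z * ζ - 4 * z ^ 2 * ζ + 18 * s ^ 2 * x
    * y * ζ - 18 * s ^ 2 * x * z * ζ - 9 * s * y ^ 2 * ζ + 27 * s ^ 2 * x ^ 2 - 27 * s * x * y -
    27 * s ^ 2 * x * y - 27 * s ^ 3 * x * y - 63 * s ^ 2 * x * z + 9 * s * y * z - 27 * s ^ 3 * x
    * z + 9 * s ^ 2 * y * z + 18 * s * x ^ 2 - 63 * s * x * z + 2 * y * z + 2 * z ^ 2 - 30 * x * z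
    + 15 * s * y ^ 2 + 9 * s ^ 2 * y ^ 2 - 6 * x * y + 8 * y ^ 2 + 6 * s * z ^ 2) * hζ + (-9 * s *
    x ^ 2 * ζ ^ 2 + 9 * s * x ^ 2 - 9 * s * x ^ 2 * ζ ^ 3 + 9 * s * x * y * ζ ^ 3 + 9 * s * x * y
    * ζ ^ 2 + 9 * s * x * y + 9 * s * x * z * ζ ^ 3 + 9 * s * x * z * ζ ^ 2 + 9 * s * x * z - y ^
    2 + y * z + 2 * z ^ 2 - 12 * x * y * ζ - 6 * y ^ 2 * ζ ^ 2 + 12 * x * z * ζ + 3 * z ^ 2 * ζ +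
    3 * z ^ 2 * ζ ^ 2 + 9 * x * z - 3 * x * y - 12 * x ^ 2 - 3 * z ^ 2 * ζ ^ 3 + 6 * x * y * ζ ^ 2
    + 18 * x * z * ζ ^ 3 + 12 * x * z * ζ ^ 2 - 3 * y * z * ζ ^ 3 - 3 * y * z * ζ ^ 2 - 3 * y ^ 2
    * ζ) * hs

lemma conic_refl₂_three [CharZero K] {ζ s : K} (hζ : 1 + ζ + ζ ^ 2 + ζ ^ 3 + ζ ^ 4 = 0)
    (hs : 3 * s ^ 2 + 3 * s + 2 = 0) (x y z : K) :
    conicForm s (ζ ^ 2) (ζ ^ 3) (x + (-1 - s) * y + (-1 - s) * z)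
      (-(3 * (-1 - s) + 3) * x + (-1 - (ζ + ζ ^ 4)) * y + (ζ + ζ ^ 4) * z)
      (-(3 * (-1 - s) + 3) * x + (ζ + ζ ^ 4) * y + (-1 - (ζ + ζ ^ 4)) * z)
      = 5 * conicForm s (ζ ^ 2) (ζ ^ 3) x y z := by
  simp only [conicForm]
  linear_combination (-3 * s * y ^ 2 * ζ ^ 10 + 6 * s * y * z * ζ ^ 10 - 3 * s * z ^ 2 * ζ ^ 10
    + 3 * s * y ^ 2 * ζ ^ 9 - 6 * s * y * z * ζ ^ 9 + 3 * s * z ^ 2 * ζ ^ 9 - 3 * s * y ^ 2 * ζ ^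
    8 + 6 * s * y * z * ζ ^ 8 - 3 * s * z ^ 2 * ζ ^ 8 - 3 * s * y ^ 2 * ζ ^ 7 + 6 * s * y * z * ζ
    ^ 7 - 3 * s * z ^ 2 * ζ ^ 7 - 18 * s ^ 2 * x * y * ζ ^ 6 + 18 * s ^ 2 * x * z * ζ ^ 6 + 6 * s
    * y ^ 2 * ζ ^ 6 - 6 * s * y * z * ζ ^ 6 - 9 * s * y ^ 2 * ζ ^ 5 + 12 * s * y * z * ζ ^ 5 - 3 *
    s * z ^ 2 * ζ ^ 5 + 18 * s ^ 2 * x * y * ζ ^ 5 - 18 * s ^ 2 * x * z * ζ ^ 5 + 18 * s ^ 2 * x *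
    y * ζ ^ 4 - 18 * s ^ 2 * x * z * ζ ^ 4 - 3 * s * y ^ 2 * ζ ^ 4 - 2 * y ^ 2 * ζ ^ 4 + 4 * y * z
    * ζ ^ 4 - 2 * z ^ 2 * ζ ^ 4 + 3 * s * z ^ 2 * ζ ^ 4 + 9 * s * x * y * ζ ^ 3 - 9 * s * x * z *
    ζ ^ 3 - 6 * s * y ^ 2 * ζ ^ 3 - 9 * s ^ 2 * y ^ 2 * ζ ^ 3 + 12 * s * z ^ 2 * ζ ^ 3 + 9 * s ^ 2
    * z ^ 2 * ζ ^ 3 + 6 * x * y * ζ ^ 3 - 6 * x * z * ζ ^ 3 - 4 * y ^ 2 * ζ ^ 3 + 8 * z ^ 2 * ζ ^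
    3 - 6 * s * y * z * ζ ^ 3 - 36 * s ^ 2 * x * y * ζ ^ 3 + 36 * s ^ 2 * x * z * ζ ^ 3 - 4 * y *
    z * ζ ^ 3 - 18 * s * x * y * ζ ^ 2 + 18 * s * x * z * ζ ^ 2 + 24 * s * y ^ 2 * ζ ^ 2 + 18 * s
    ^ 2 * y ^ 2 * ζ ^ 2 - 18 * s * z ^ 2 * ζ ^ 2 - 18 * s ^ 2 * z ^ 2 * ζ ^ 2 - 12 * x * y * ζ ^ 2
    + 12 * x * z * ζ ^ 2 + 12 * y ^ 2 * ζ ^ 2 - 12 * z ^ 2 * ζ ^ 2 - 27 * s ^ 3 * x ^ 2 * ζ ^ 2 +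
    18 * s ^ 2 * x * y * ζ ^ 2 + 6 * s * y * z * ζ ^ 2 + 6 * s * y * z * ζ - 10 * y ^ 2 * ζ + 8 *
    y * z * ζ + 2 * z ^ 2 * ζ - 18 * s ^ 2 * x * z * ζ + 9 * s * x * y * ζ - 9 * s * x * z * ζ -
    18 * s * y ^ 2 * ζ - 9 * s ^ 2 * y ^ 2 * ζ + 9 * s ^ 2 * z ^ 2 * ζ + 6 * x * y * ζ - 6 * x * z
    * ζ + 27 * s ^ 3 * x ^ 2 * ζ - 3 * s * y ^ 2 + 15 * s * z ^ 2 - 4 * y ^ 2 + 8 * z ^ 2 + 18 * s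
    ^ 2 * x * y - 4 * y * z + 9 * s * x * y - 9 * s * x * z - 9 * s ^ 2 * y ^ 2 + 9 * s ^ 2 * z ^
    2 + 6 * x * y - 6 * x * z - 27 * s ^ 3 * x ^ 2) * hζ + (-9 * s * x * y * ζ ^ 2 - 9 * s * x * y
    * ζ ^ 3 - 9 * s * x * z * ζ ^ 2 - 9 * s * x * z * ζ ^ 3 + 18 * s * x ^ 2 + 9 * s * x ^ 2 * ζ ^
    3 + 9 * s * x ^ 2 * ζ ^ 2 + 5 * y ^ 2 + 4 * y * z - z ^ 2 - 18 * x * y * ζ ^ 2 - 6 * x * y * ζ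
    ^ 3 - 12 * x * z * ζ ^ 3 + 3 * y * z * ζ ^ 2 + 3 * y * z * ζ ^ 3 - 3 * x * z - 9 * x * y - 12
    * x ^ 2 + 6 * x * z * ζ + 6 * y ^ 2 * ζ ^ 3 + 6 * y ^ 2 * ζ - 6 * z ^ 2 * ζ - 6 * x * y * ζ +
    3 * y ^ 2 * ζ ^ 2 - 3 * z ^ 2 * ζ ^ 3) * hs

namespace WimanData

variable (D : WimanData K)

/-- Six conics permuted by the automorphisms of the Wiman sextic. -/
def conic : Fin 6 → (Fin 3 → K) → K :=
  ![fun v => baseConic D.s (v 0) (v 1) (v 2),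
    fun v => conicForm D.s 1 1 (v 0) (v 1) (v 2),
    fun v => conicForm D.s D.ζ (D.ζ ^ 4) (v 0) (v 1) (v 2),
    fun v => conicForm D.s (D.ζ ^ 2) (D.ζ ^ 3) (v 0) (v 1) (v 2),
    fun v => conicForm D.s (D.ζ ^ 3) (D.ζ ^ 2) (v 0) (v 1) (v 2),
    fun v => conicForm D.s (D.ζ ^ 4) D.ζ (v 0) (v 1) (v 2)]

lemma conic_smul (i : Fin 6) (μ : K) (v : Fin 3 → K) :
    D.conic i (μ • v) = μ ^ 2 * D.conic i v := by
  fin_cases i <;> simp [conic, baseConic, conicForm] <;> ring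

/-- The pairs of a matrix `A` and a permutation `σ` such that `A` permutes the six conics
according to `σ`. -/
def conicPairs : Submonoid (GL3 K × Equiv.Perm (Fin 6)) where
  carrier := {x | ∀ i, ∃ c : K, ∀ v, D.conic (x.2 i) (x.1.1.mulVec v) = c * D.conic i v}
  one_mem' i := ⟨1, fun v => by simp⟩
  mul_mem' := by
    rintro ⟨A, σ⟩ ⟨B, τ⟩ hA hB i
    obtain ⟨c, hc⟩ := hB i
    obtain ⟨d, hd⟩ := hA (τ i)
    refine ⟨d * c, fun v => ?_⟩
    simp only [Prod.mk_mul_mk, Units.val_mul, Equiv.Perm.mul_apply, ← Matrix.mulVec_mulVec] at *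
    rw [hd, hc, mul_assoc]

lemma conicPairs_of_eq_smul {A B : GL3 K} {σ : Equiv.Perm (Fin 6)} {μ : K} (h : A.1 = μ • B.1)
    (hB : (B, σ) ∈ D.conicPairs) : (A, σ) ∈ D.conicPairs := by
  intro i
  obtain ⟨c, hc⟩ := hB i
  refine ⟨μ ^ 2 * c, fun v => ?_⟩
  simp only at hc ⊢
  rw [h, Matrix.smul_mulVec, conic_smul, hc, mul_assoc]

/-- The permutation of the conics given by `rot`. -/
def rotPerm : Equiv.Perm (Fin 6) :=
  ⟨![0, 5, 1, 2, 3, 4], ![0, 2, 3, 4, 5, 1], by decide, by decide⟩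

/-- The permutation of the conics given by `flip`. -/
def flipPerm : Equiv.Perm (Fin 6) :=
  ⟨![0, 1, 5, 4, 3, 2], ![0, 1, 5, 4, 3, 2], by decide, by decide⟩

/-- The permutation of the conics given by `refl₁`. -/
def reflPerm₁ : Equiv.Perm (Fin 6) :=
  ⟨![0, 1, 3, 2, 5, 4], ![0, 1, 3, 2, 5, 4], by decide, by decide⟩

/-- The permutation of the conics given by `refl₂`. -/
def reflPerm₂ : Equiv.Perm (Fin 6) :=
  ⟨![1, 0, 5, 3, 4, 2], ![1, 0, 5, 3, 4, 2], by decide, by decide⟩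

lemma rot_mem_conicPairs : (D.rot, rotPerm) ∈ D.conicPairs := by
  intro i
  refine ⟨1, fun v => ?_⟩
  have h5 := D.ζ_pow_five
  have hm : D.rot.1.mulVec v = ![v 0, D.ζ * v 1, D.ζ ^ 4 * v 2] := by
    ext j; fin_cases j <;> simp [rot, Matrix.mulVec, dotProduct, Fin.sum_univ_three]
  have key (u w u' w' : K) (hu : u * D.ζ = u') (hw : w * D.ζ ^ 4 = w') :
      conicForm D.s u w (v 0) (D.ζ * v 1) (D.ζ ^ 4 * v 2)
        = 1 * conicForm D.s u' w' (v 0) (v 1) (v 2) := by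
    rw [← hu, ← hw, conicForm, conicForm]
    linear_combination (2 + 3 * D.s) * v 1 * v 2 * h5
  simp only [hm]
  fin_cases i
  · simp only [conic, rotPerm, baseConic, Equiv.coe_fn_mk, Fin.zero_eta, Matrix.cons_val]
    linear_combination -(3 * D.s + 2) * v 1 * v 2 * h5
  · exact key _ _ _ _ (by linear_combination h5) (by linear_combination h5)
  · exact key _ _ _ _ (by ring) (by ring)
  · exact key _ _ _ _ (by ring) (by linear_combination D.ζ ^ 3 * h5)
  · exact key _ _ _ _ (by ring) (by linear_combination D.ζ ^ 2 * h5)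
  · exact key _ _ _ _ (by ring) (by linear_combination D.ζ * h5)

lemma flip_mem_conicPairs : (D.flip, flipPerm) ∈ D.conicPairs := by
  intro i
  refine ⟨1, fun v => ?_⟩
  have hm : D.flip.1.mulVec v = ![v 0, v 2, v 1] := by
    ext j; fin_cases j <;> simp [flip, Matrix.mulVec, dotProduct, Fin.sum_univ_three]
  simp only [hm]
  fin_cases i <;> simp [conic, flipPerm, baseConic, conicForm] <;> ring

variable [CharZero K]

lemma refl₁_mulVec (v : Fin 3 → K) : D.refl₁.1.mulVec v = ![v 0 + D.s * v 1 + D.s * v 2,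
    -(3 * D.s + 3) * v 0 + (-1 - (D.ζ + D.ζ ^ 4)) * v 1 + (D.ζ + D.ζ ^ 4) * v 2,
    -(3 * D.s + 3) * v 0 + (D.ζ + D.ζ ^ 4) * v 1 + (-1 - (D.ζ + D.ζ ^ 4)) * v 2] := by
  ext j; fin_cases j <;>
    simp [refl₁, reflUnit, reflMatrix, Matrix.mulVec, dotProduct, Fin.sum_univ_three]

lemma refl₂_mulVec (v : Fin 3 → K) : D.refl₂.1.mulVec v =
    ![v 0 + (-1 - D.s) * v 1 + (-1 - D.s) * v 2,
    -(3 * (-1 - D.s) + 3) * v 0 + (-1 - (D.ζ + D.ζ ^ 4)) * v 1 + (D.ζ + D.ζ ^ 4) * v 2,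
    -(3 * (-1 - D.s) + 3) * v 0 + (D.ζ + D.ζ ^ 4) * v 1 + (-1 - (D.ζ + D.ζ ^ 4)) * v 2] := by
  ext j; fin_cases j <;>
    simp [refl₂, reflUnit, reflMatrix, Matrix.mulVec, dotProduct, Fin.sum_univ_three]

lemma refl₁_mem_conicPairs : (D.refl₁, reflPerm₁) ∈ D.conicPairs := by
  intro i
  simp only [refl₁_mulVec]
  have h2 := conic_refl₁_two D.hζ D.hs
  have h3 := conic_refl₁_three D.hζ D.hs
  fin_cases i
  · exact ⟨_, fun v => conic_refl₁_zero D.hζ D.hs (v 0) (v 1) (v 2)⟩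
  · exact ⟨_, fun v => conic_refl₁_one D.hζ D.hs (v 0) (v 1) (v 2)⟩
  · exact ⟨_, fun v => h2 (v 0) (v 1) (v 2)⟩
  · exact ⟨_, fun v => h3 (v 0) (v 1) (v 2)⟩
  · refine ⟨3 * D.ζ ^ 2 - 1 + 3 * D.ζ ^ 3 + 3 * D.s + 6 * D.s * D.ζ ^ 2 + 6 * D.s * D.ζ ^ 3,
      fun v => ?_⟩
    have h := h3 (v 0) (v 2) (v 1)
    simp only [conicForm] at h
    simp only [conic, reflPerm₁, conicForm, Equiv.coe_fn_mk, Fin.reduceFinMk, Matrix.cons_val]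
    linear_combination h
  · refine ⟨-4 - 3 * D.ζ ^ 2 - 3 * D.ζ ^ 3 - 3 * D.s - 6 * D.s * D.ζ ^ 2 - 6 * D.s * D.ζ ^ 3,
      fun v => ?_⟩
    have h := h2 (v 0) (v 2) (v 1)
    simp only [conicForm] at h
    simp only [conic, reflPerm₁, conicForm, Equiv.coe_fn_mk, Fin.reduceFinMk, Matrix.cons_val]
    linear_combination h

lemma refl₂_mem_conicPairs : (D.refl₂, reflPerm₂) ∈ D.conicPairs := by
  intro i
  simp only [refl₂_mulVec]
  have h2 := conic_refl₂_two D.hζ D.hs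
  have h3 := conic_refl₂_three D.hζ D.hs
  fin_cases i
  · exact ⟨_, fun v => conic_refl₂_zero D.hζ D.hs (v 0) (v 1) (v 2)⟩
  · exact ⟨_, fun v => conic_refl₂_one D.hζ D.hs (v 0) (v 1) (v 2)⟩
  · exact ⟨_, fun v => h2 (v 0) (v 1) (v 2)⟩
  · exact ⟨_, fun v => h3 (v 0) (v 1) (v 2)⟩
  · refine ⟨5, fun v => ?_⟩
    have h := h3 (v 0) (v 2) (v 1)
    simp only [conicForm] at h
    simp only [conic, reflPerm₂, conicForm, Equiv.coe_fn_mk, Fin.reduceFinMk, Matrix.cons_val]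
    linear_combination h
  · refine ⟨5, fun v => ?_⟩
    have h := h2 (v 0) (v 2) (v 1)
    simp only [conicForm] at h
    simp only [conic, reflPerm₂, conicForm, Equiv.coe_fn_mk, Fin.reduceFinMk, Matrix.cons_val]
    linear_combination h

end WimanData

namespace WimanData

variable (D : WimanData K)

lemma s_ne_zero [CharZero K] : D.s ≠ 0 := by
  intro h
  have := D.hs
  simp [h] at this

lemma isPrimitiveRoot [CharZero K] : IsPrimitiveRoot D.ζ 5 := by
  have : Fact (Nat.Prime 5) := ⟨Nat.prime_five⟩
  rw [IsPrimitiveRoot.iff_orderOf]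
  refine orderOf_eq_prime D.ζ_pow_five fun h => ?_
  have := D.hζ
  rw [h] at this
  norm_num at this

lemma conic_injective [CharZero K] {k l : Fin 6}
    (h : ∀ v w, D.conic k v * D.conic l w = D.conic k w * D.conic l v) : k = l := by
  have hs := D.s_ne_zero
  have hζ : D.ζ ≠ 0 := D.isPrimitiveRoot.ne_zero (by norm_num)
  have h5 := D.ζ_pow_five
  let e : Fin 5 → Fin 5 := ![0, 2, 4, 1, 3]
  have hx₀ : D.conic 0 ![1, 0, 0] = 3 := by simp [conic, baseConic]
  have hy₀ : D.conic 0 ![0, 1, 0] = 0 := by simp [conic, baseConic]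
  have hx (i : Fin 5) : D.conic i.succ ![1, 0, 0] = 6 := by
    fin_cases i <;> simp [conic, conicForm]
  have hy (i : Fin 5) : D.conic i.succ ![0, 1, 0] = -3 * D.s * D.ζ ^ (e i : ℕ) := by
    fin_cases i <;> simp [conic, conicForm, e]
    · left; ring
    · left; linear_combination D.ζ * h5
    · left; linear_combination D.ζ ^ 3 * h5
  have h1 := h ![1, 0, 0] ![0, 1, 0]
  induction k using Fin.cases with
  | zero =>
    induction l using Fin.cases with
    | zero => rfl
    | succ l => simp [hx₀, hy₀, hx, hy, hs, hζ] at h1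
  | succ k =>
    induction l using Fin.cases with
    | zero => simp [hx₀, hy₀, hx, hy, hs, hζ] at h1
    | succ l =>
      rw [hx, hx, hy, hy] at h1
      have h2 : D.ζ ^ (e l : ℕ) = D.ζ ^ (e k : ℕ) := by
        have h18 : -18 * D.s ≠ 0 := mul_ne_zero (by norm_num) hs
        exact mul_left_cancel₀ h18 (by linear_combination h1)
      have h3 := Fin.ext (D.isPrimitiveRoot.pow_inj (e l).2 (e k).2 h2)
      have he : Function.Injective e := by decide
      rw [he h3]

lemma perm_unique [CharZero K] {A B : GL3 K} {σ τ : Equiv.Perm (Fin 6)}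
    (hA : (A, σ) ∈ D.conicPairs) (hB : (B, τ) ∈ D.conicPairs)
    (h : (QuotientGroup.mk A : PGL3 K) = QuotientGroup.mk B) : σ = τ := by
  obtain ⟨μ, hμ⟩ : ∃ μ : K, B.1 = μ • A.1 := by
    rw [QuotientGroup.eq, Matrix.GeneralLinearGroup.mem_center_iff_val_mem_range_scalar] at h
    obtain ⟨μ, hμ⟩ := h
    refine ⟨μ, ?_⟩
    rw [← mul_inv_cancel_left A B, Units.val_mul, ← hμ, Matrix.scalar_apply,
      ← Matrix.smul_eq_mul_diagonal]
  have hB' : (B, σ) ∈ D.conicPairs := D.conicPairs_of_eq_smul hμ hA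
  ext1 i
  obtain ⟨c, hc⟩ := hB' i
  obtain ⟨d, hd⟩ := hB i
  refine D.conic_injective fun v w => ?_
  have key (v : Fin 3 → K) : B.1.mulVec (B⁻¹.1.mulVec v) = v := by simp
  rw [← key v, ← key w, hc, hc, hd, hd]
  ring

variable [CharZero K]

lemma exists_mem_conicPairs [IsAlgClosed K] {A : GL3 K} (hA : A ∈ wimanStabilizer K) :
    ∃ σ, (A, σ) ∈ D.conicPairs := by
  let M := D.conicPairs.map (MonoidHom.fst (GL3 K) (Equiv.Perm (Fin 6)))
  have hM {B σ} (h : (B, σ) ∈ D.conicPairs) : B ∈ M := ⟨(B, σ), h, rfl⟩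
  have hrot := hM D.rot_mem_conicPairs
  have h₁ := hM D.refl₁_mem_conicPairs
  have h₂ := hM D.refl₂_mem_conicPairs
  have hrep : ∀ i, D.rep i ∈ M
    | .inl k => mul_mem (mul_mem h₁ (pow_mem hrot _)) h₂
    | .inr 0 => h₁
    | .inr 1 => h₂
  have hcoset : ∀ w, D.cosetRep w ∈ M
    | none => one_mem _
    | some (i, j) => mul_mem (hrep i) (pow_mem hrot _)
  obtain ⟨x, μ, -, hμ⟩ := D.exists_eq_smul_word hA
  obtain ⟨⟨B, σ⟩, h, rfl : B = _⟩ : D.word x ∈ M :=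
    mul_mem (mul_mem (pow_mem hrot _) (pow_mem (hM D.flip_mem_conicPairs) _)) (hcoset _)
  exact ⟨σ, D.conicPairs_of_eq_smul hμ h⟩

/-- The automorphisms of the Wiman sextic act on the six conics. -/
lemma exists_monoidHom [IsAlgClosed K] :
    ∃ φ : planeAut (wimanSextic K) →* Equiv.Perm (Fin 6),
      ∀ A ∈ wimanStabilizer K, ∀ σ, (A, σ) ∈ D.conicPairs → σ ∈ φ.range := by
  have h (g : planeAut (wimanSextic K)) : ∃ σ : Equiv.Perm (Fin 6), ∃ A : GL3 K,
      QuotientGroup.mk A = g.1 ∧ (A, σ) ∈ D.conicPairs := by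
    obtain ⟨A, hA, e⟩ := mem_planeAut_wimanSextic.1 g.2
    obtain ⟨σ, hσ⟩ := D.exists_mem_conicPairs hA
    exact ⟨σ, A, e, hσ⟩
  choose φ B hB hφ using h
  refine ⟨MonoidHom.mk' φ fun g h => D.perm_unique (hφ _) (mul_mem (hφ g) (hφ h)) ?_,
    fun A hA σ hσ => ⟨⟨QuotientGroup.mk A, mem_planeAut_wimanSextic.2 ⟨A, hA, rfl⟩⟩,
      D.perm_unique (hφ _) hσ (hB _)⟩⟩
  rw [hB, QuotientGroup.mk_mul, hB, hB, Subgroup.coe_mul]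

end WimanData

lemma alternatingGroup_le_of_rotPerm_mem {G : Subgroup (Equiv.Perm (Fin 6))}
    (hrot : WimanData.rotPerm ∈ G) (h₁ : WimanData.reflPerm₁ ∈ G)
    (h₂ : WimanData.reflPerm₂ ∈ G) : alternatingGroup (Fin 6) ≤ G := by
  have key : ∀ a b : Fin 6, a ≠ b → ∃ i k : Fin 5, ∃ j : Fin 2,
      (WimanData.rotPerm ^ (i : ℕ) * WimanData.reflPerm₂ ^ (j : ℕ) *
        WimanData.rotPerm ^ (k : ℕ)) 0 = a ∧
      (WimanData.rotPerm ^ (i : ℕ) * WimanData.reflPerm₂ ^ (j : ℕ) *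
        WimanData.rotPerm ^ (k : ℕ)) 1 = b := by
    decide
  have hG : ∀ a b : Fin 6, a ≠ b → ∃ g : G, g • (0 : Fin 6) = a ∧ g • (1 : Fin 6) = b := by
    intro a b hab
    obtain ⟨i, k, j, ha, hb⟩ := key a b hab
    exact ⟨⟨_, mul_mem (mul_mem (pow_mem hrot i) (pow_mem h₂ j)) (pow_mem hrot k)⟩, ha, hb⟩
  refine Equiv.Perm.alternatingGroup_le_of_isPreprimitive_of_isThreeCycle_mem
    (g := WimanData.rotPerm * WimanData.reflPerm₁)
    (MulAction.isPreprimitive_of_is_two_pretransitive (MulAction.is_two_pretransitive_iff.2 ?_))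
    (card_support_eq_three_iff.1 (by decide)) (mul_mem hrot h₁)
  intro a b c d hab hcd
  obtain ⟨g, rfl, rfl⟩ := hG a b hab
  obtain ⟨h, rfl, rfl⟩ := hG c d hcd
  exact ⟨h * g⁻¹, by simp [mul_smul], by simp [mul_smul]⟩

theorem nonempty_mulEquiv_and_card [IsAlgClosed K] [CharZero K] :
    Nonempty (planeAut (wimanSextic K) ≃* alternatingGroup (Fin 6)) ∧
      Nat.card (planeAut (wimanSextic K)) = 360 := by
  obtain ⟨D⟩ := nonempty_wimanData (K := K)
  obtain ⟨φ, hφ⟩ := D.exists_monoidHom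
  obtain ⟨_, hle⟩ := finite_planeAut_and_card_le (K := K)
  have h6 : Nat.card (alternatingGroup (Fin 6)) = 360 := by
    rw [nat_card_alternatingGroup, Nat.card_fin]
    rfl
  have halt : alternatingGroup (Fin 6) ≤ φ.range := alternatingGroup_le_of_rotPerm_mem
    (hφ _ D.rot_mem _ D.rot_mem_conicPairs) (hφ _ D.refl₁_mem _ D.refl₁_mem_conicPairs)
    (hφ _ D.refl₂_mem _ D.refl₂_mem_conicPairs)
  have h1 : 360 ≤ Nat.card φ.range := h6 ▸ Subgroup.card_le_of_le halt
  have hbij := φ.rangeRestrict_surjective.bijective_of_nat_card_le (hle.trans h1)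
  have hcard := Nat.card_eq_of_bijective _ hbij
  have hrange : alternatingGroup (Fin 6) = φ.range :=
    Subgroup.eq_of_le_of_card_ge halt (by rw [h6, ← hcard]; exact hle)
  have e : planeAut (wimanSextic K) ≃* alternatingGroup (Fin 6) :=
    (MulEquiv.ofBijective _ hbij).trans (MulEquiv.subgroupCongr hrange.symm)
  exact ⟨⟨e⟩, (Nat.card_congr e.toEquiv).trans h6⟩

/-- The Wiman sextic is a smooth plane sextic over `K`, its automorphism group is
isomorphic to the alternating group `A₆` on six letters, and in particular it has order `360`. -/
theorem wiman_sextic_automorphisms {K : Type*} [Field K] [IsAlgClosed K] [CharZero K] :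
    IsSmoothSextic (wimanSextic K) ∧
    Nonempty (↥(planeAut (wimanSextic K)) ≃* ↥(alternatingGroup (Fin 6))) ∧
    Nat.card ↥(planeAut (wimanSextic K)) = 360 := by
  exact ⟨isSmoothSextic_wimanSextic, nonempty_mulEquiv_and_card⟩
end

section
/- The Fermat sextic F₆ defined by X⁶ + Y⁶ + Z⁶ = 0 is a smooth plane sextic over K; its automorphism group Aut(F₆) ⊂ PGL₃(K) equals the subgroup generated by diag(ζ₆,1,1), diag(1,ζ₆,1), [X:Z:Y] and [Y:Z:X], and |Aut(F₆)| = 216. -/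
open MvPolynomial

variable {K : Type*} [Field K]

/-- The Fermat sextic `X⁶ + Y⁶ + Z⁶`. -/
noncomputable def fermatSextic (K : Type*) [Field K] : MvPolynomial (Fin 3) K :=
  X 0 ^ 6 + X 1 ^ 6 + X 2 ^ 6

/-- The monomial matrix whose `i`-th row has the single nonzero entry `d i`, in column `σ i`. -/
def monomialGL (d : Fin 3 → Kˣ) (σ : Equiv.Perm (Fin 3)) : GL3 K where
  val := Matrix.of fun i j => if σ i = j then (d i : K) else 0
  inv := Matrix.of fun i j => if σ j = i then (↑(d j)⁻¹ : K) else 0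
  val_inv := by
    ext i k
    by_cases h : i = k
    · subst h
      simp [Matrix.mul_apply]
    · simp [Matrix.mul_apply, h]
  inv_val := by
    ext i k
    rw [Matrix.mul_apply, Finset.sum_eq_single (σ.symm i)]
    · simp [Matrix.one_apply]
    · intro j _ hj
      have : σ j ≠ i := fun h => hj (by simp [← h])
      simp [this]
    · simp

lemma monomialGL_apply (d : Fin 3 → Kˣ) (σ : Equiv.Perm (Fin 3)) (i j : Fin 3) :
    (monomialGL d σ : Matrix (Fin 3) (Fin 3) K) i j = if σ i = j then (d i : K) else 0 := rfl

lemma monomialGL_mul (d e : Fin 3 → Kˣ) (σ τ : Equiv.Perm (Fin 3)) :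
    monomialGL d σ * monomialGL e τ = monomialGL (fun i => d i * e (σ i)) (τ * σ) := by
  ext i k
  rw [Units.val_mul, Matrix.mul_apply, Finset.sum_eq_single (σ i)]
  · by_cases h : τ (σ i) = k <;> simp [monomialGL_apply, h]
  · intro j _ hj
    simp [monomialGL_apply, hj.symm]
  · simp

lemma monomialGL_one : monomialGL (1 : Fin 3 → Kˣ) 1 = 1 := by
  ext i k
  rw [monomialGL_apply, Units.val_one, Matrix.one_apply]
  rfl

lemma monomialGL_diag_pow (d : Fin 3 → Kˣ) (n : ℕ) :
    monomialGL d 1 ^ n = monomialGL (d ^ n) 1 := by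
  induction n with
  | zero => rw [pow_zero, pow_zero, monomialGL_one]
  | succ n ih => rw [pow_succ, ih, monomialGL_mul, pow_succ]; rfl

lemma pgl_coe (A : GL3 K) : pgl (A : Matrix (Fin 3) (Fin 3) K) = (QuotientGroup.mk A : PGL3 K) := by
  unfold pgl
  rw [dif_pos A.isUnit]
  congr 1
  ext
  rfl

lemma mk_eq_mk_of_val_eq_smul {A B : GL3 K} {s : K}
    (h : (B : Matrix (Fin 3) (Fin 3) K) = s • (A : Matrix (Fin 3) (Fin 3) K)) :
    (QuotientGroup.mk A : PGL3 K) = QuotientGroup.mk B := by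
  rw [QuotientGroup.eq, Subgroup.mem_center_iff]
  have hs : ((A⁻¹ * B : GL3 K) : Matrix (Fin 3) (Fin 3) K) = s • 1 := by
    rw [Units.val_mul, h, mul_smul_comm, ← Units.val_mul, inv_mul_cancel, Units.val_one]
  intro g
  apply Units.ext
  rw [Units.val_mul g, Units.val_mul _ g, hs]
  simp

lemma exists_val_eq_smul_of_mk_eq_mk {A B : GL3 K}
    (h : (QuotientGroup.mk A : PGL3 K) = QuotientGroup.mk B) :
    ∃ s : K, (B : Matrix (Fin 3) (Fin 3) K) = s • (A : Matrix (Fin 3) (Fin 3) K) := by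
  rw [QuotientGroup.eq] at h
  obtain ⟨s, hs⟩ := Matrix.GeneralLinearGroup.mem_center_iff_val_mem_range_scalar.mp h
  refine ⟨s, ?_⟩
  have : B = A * (A⁻¹ * B) := by group
  rw [this, Units.val_mul, ← hs, Matrix.scalar_apply,
    ← Matrix.smul_one_eq_diagonal, mul_smul_comm, mul_one]

lemma matAct_fermatSextic (A : Matrix (Fin 3) (Fin 3) K) :
    matAct A (fermatSextic K) = ∑ i, (∑ j, C (A i j) * X j) ^ 6 := by
  simp [matAct, fermatSextic, Fin.sum_univ_three]

lemma matAct_monomialGL_fermatSextic (d : Fin 3 → Kˣ) (σ : Equiv.Perm (Fin 3)) (c : K)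
    (hd : ∀ i, (d i : K) ^ 6 = c) :
    matAct (monomialGL d σ : Matrix (Fin 3) (Fin 3) K) (fermatSextic K) = c • fermatSextic K := by
  have h : ∀ i, (∑ j, C ((monomialGL d σ : Matrix (Fin 3) (Fin 3) K) i j) * X j) ^ 6
      = c • (X (σ i) : MvPolynomial (Fin 3) K) ^ 6 := by
    intro i
    simp [monomialGL_apply, apply_ite C, mul_pow, ← hd i, smul_eq_C_mul]
  rw [matAct_fermatSextic, Finset.sum_congr rfl fun i _ => h i, ← Finset.smul_sum,
    Equiv.sum_comp σ fun j => (X j : MvPolynomial (Fin 3) K) ^ 6, Fin.sum_univ_three, fermatSextic]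

lemma mk_monomialGL_mem_planeAut (d : Fin 3 → Kˣ) (σ : Equiv.Perm (Fin 3))
    (hd : ∀ i, (d i : K) ^ 6 = 1) :
    (QuotientGroup.mk (monomialGL d σ) : PGL3 K) ∈ planeAut (fermatSextic K) :=
  ⟨_, rfl, 1, one_ne_zero, matAct_monomialGL_fermatSextic d σ 1 hd⟩

lemma isSmoothSextic_fermatSextic [CharZero K] : IsSmoothSextic (fermatSextic K) := by
  refine ⟨?_, fun p _ hp => ?_⟩
  · exact ((isHomogeneous_X_pow 0 6).add (isHomogeneous_X_pow 1 6)).add (isHomogeneous_X_pow 2 6)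
  · funext i
    have := hp i
    fin_cases i <;> simpa [fermatSextic, pderiv_pow, pderiv_X] using this

/-- Comparing mixed second partial derivatives of `F(AX)` and `c • F` shows that each row of `A`
has at most one nonzero entry. -/
lemma mul_eq_zero_of_matAct_fermatSextic [CharZero K] {A : GL3 K} {c : K}
    (h : matAct (A : Matrix (Fin 3) (Fin 3) K) (fermatSextic K) = c • fermatSextic K)
    (i : Fin 3) {j k : Fin 3} (hjk : j ≠ k) :
    (A : Matrix (Fin 3) (Fin 3) K) i j * (A : Matrix (Fin 3) (Fin 3) K) i k = 0 := by
  set M : Matrix (Fin 3) (Fin 3) K := A.val with hM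
  set p : Fin 3 → K := fun l => (↑A⁻¹ : Matrix (Fin 3) (Fin 3) K) l i with hp
  have hMp : ∀ l, ∑ m, M l m * p m = if l = i then 1 else 0 := by
    intro l
    have : (M * (↑A⁻¹ : Matrix (Fin 3) (Fin 3) K)) l i = (1 : Matrix (Fin 3) (Fin 3) K) l i := by
      rw [hM, ← Units.val_mul, mul_inv_cancel, Units.val_one]
    rwa [Matrix.mul_apply, Matrix.one_apply] at this
  have hL : ∀ l n, pderiv n (∑ m, C (M l m) * X m) = C (M l n) := by
    intro l n
    simp [pderiv_X, Pi.single_apply]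
  have h6 : ∀ n, pderiv n (6 : MvPolynomial (Fin 3) K) = 0 := fun n => (pderiv n).map_natCast 6
  have h0 : pderiv k (pderiv j (c • fermatSextic K)) = 0 := by
    fin_cases j <;> fin_cases k <;>
      first | exact absurd rfl hjk | simp [fermatSextic, pderiv_X, h6]
  rw [← h, matAct_fermatSextic] at h0
  have h1 := congrArg (eval p) h0
  simp only [map_sum, pderiv_pow, Derivation.leibniz, hL, smul_eq_mul, pderiv_C, mul_zero] at h1
  simpa [hMp, h6] using h1

lemma exists_monomialGL_of_matAct_fermatSextic [CharZero K] {A : GL3 K} {c : K}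
    (h : matAct (A : Matrix (Fin 3) (Fin 3) K) (fermatSextic K) = c • fermatSextic K) :
    ∃ d σ, A = monomialGL d σ ∧ ∀ i, (d i : K) ^ 6 = c := by
  have hrow : ∀ i, ∃ j, (A : Matrix (Fin 3) (Fin 3) K) i j ≠ 0 := by
    intro i
    by_contra! h0
    have := congrFun (congrFun (Units.mul_inv A) i) i
    simp [Matrix.mul_apply, h0] at this
  have hcol : ∀ j, ∃ i, (A : Matrix (Fin 3) (Fin 3) K) i j ≠ 0 := by
    intro j
    by_contra! h0
    have := congrFun (congrFun (Units.inv_mul A) j) j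
    simp [Matrix.mul_apply, h0] at this
  choose s hs using hrow
  have hs0 : ∀ i j, s i ≠ j → (A : Matrix (Fin 3) (Fin 3) K) i j = 0 := fun i j hij =>
    (mul_eq_zero.mp (mul_eq_zero_of_matAct_fermatSextic h i hij)).resolve_left (hs i)
  have hsurj : Function.Surjective s := fun j => by
    obtain ⟨i, hi⟩ := hcol j
    exact ⟨i, by_contra fun hij => hi (hs0 i j hij)⟩
  set σ := Equiv.ofBijective s (Finite.injective_iff_bijective.mp
    (Finite.injective_iff_surjective.mpr hsurj)) with hσ
  have hA : A = monomialGL (fun i => Units.mk0 _ (hs i)) σ := by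
    ext i j
    rw [monomialGL_apply]
    split_ifs with hij
    · simp [← hij, hσ]
    · exact hs0 i j hij
  refine ⟨_, σ, hA, fun i => ?_⟩
  have h1 := congrArg (eval (Pi.single (σ i) (1 : K))) h
  rw [matAct_fermatSextic, hA] at h1
  have h2 : eval (Pi.single (σ i) (1 : K)) (fermatSextic K) = 1 := by
    generalize σ i = j
    fin_cases j <;> simp [fermatSextic]
  rw [smul_eval, h2, mul_one] at h1
  simpa [monomialGL_apply, Pi.single_apply, ite_pow] using h1

/-- The monomial matrix with permutation `σ` and nonzero entries `u ^ a`, `u ^ b`, `1`. -/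
def rootGL (u : Kˣ) (x : (Fin 6 × Fin 6) × Equiv.Perm (Fin 3)) : GL3 K :=
  monomialGL ![u ^ (x.1.1 : ℕ), u ^ (x.1.2 : ℕ), 1] x.2

lemma mk_rootGL_injective {u : Kˣ} (hu : IsPrimitiveRoot u 6) :
    Function.Injective fun x => (QuotientGroup.mk (rootGL u x) : PGL3 K) := by
  rintro ⟨⟨a, b⟩, σ⟩ ⟨⟨a', b'⟩, σ'⟩ h
  obtain ⟨s, hs⟩ := exists_val_eq_smul_of_mk_eq_mk h
  have hs' := fun i j => congrFun (congrFun hs i) j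
  simp only [rootGL, Matrix.smul_apply, monomialGL_apply, smul_eq_mul] at hs'
  have hσ : σ = σ' := by
    ext1 i
    by_contra hne
    have := hs' i (σ' i)
    rw [if_pos rfl, if_neg hne, mul_zero] at this
    exact Units.ne_zero _ this
  subst hσ
  have hd := fun i => hs' i (σ i)
  simp only [if_true] at hd
  have hs1 : s = 1 := by simpa using (hd 2).symm
  have hpow : ∀ {m n : Fin 6}, u ^ (m : ℕ) = u ^ (n : ℕ) → m = n := fun {m n} hmn =>
    Fin.ext (hu.pow_inj m.2 n.2 hmn)
  have ha : a' = a := hpow (Units.ext (by simpa [hs1] using hd 0))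
  have hb : b' = b := hpow (Units.ext (by simpa [hs1] using hd 1))
  rw [ha, hb]

lemma range_mk_rootGL [CharZero K] {u : Kˣ} (hu : IsPrimitiveRoot u 6) :
    Set.range (fun x => (QuotientGroup.mk (rootGL u x) : PGL3 K)) = planeAut (fermatSextic K) := by
  have hu6 : (u : K) ^ 6 = 1 := by rw [← Units.val_pow_eq_pow_val, hu.pow_eq_one, Units.val_one]
  apply Set.Subset.antisymm
  · rintro _ ⟨x, rfl⟩
    refine mk_monomialGL_mem_planeAut _ _ fun i => ?_
    fin_cases i <;> simp [← pow_mul, mul_comm _ 6, pow_mul _ 6, hu6]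
  · rintro _ ⟨A, rfl, c, -, hA⟩
    obtain ⟨d, σ, rfl, hd⟩ := exists_monomialGL_of_matAct_fermatSextic hA
    have hroot : ∀ i, ∃ a : Fin 6, d i = u ^ (a : ℕ) * d 2 := by
      intro i
      have h1 : ((d i / d 2 : Kˣ) : K) ^ 6 = 1 := by
        rw [Units.val_div_eq_div_val, div_pow, hd, hd, div_self]
        rw [← hd 2]
        exact pow_ne_zero _ (d 2).ne_zero
      obtain ⟨a, ha, h2⟩ := (IsPrimitiveRoot.coe_units_iff.mpr hu).eq_pow_of_pow_eq_one h1
      refine ⟨⟨a, ha⟩, ?_⟩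
      rw [← div_eq_iff_eq_mul, ← Units.val_inj, ← h2, Units.val_pow_eq_pow_val]
    obtain ⟨a, ha⟩ := hroot 0
    obtain ⟨b, hb⟩ := hroot 1
    refine ⟨((a, b), σ), mk_eq_mk_of_val_eq_smul (s := (d 2 : K)) ?_⟩
    ext i j
    rw [Matrix.smul_apply, rootGL, monomialGL_apply, monomialGL_apply, smul_eq_mul, mul_ite,
      mul_zero]
    congr 1
    fin_cases i <;> simp [ha, hb, mul_comm]

lemma rootGL_eq (u : Kˣ) (x : (Fin 6 × Fin 6) × Equiv.Perm (Fin 3)) :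
    rootGL u x = monomialGL ![u, 1, 1] 1 ^ (x.1.1 : ℕ) * monomialGL ![1, u, 1] 1 ^ (x.1.2 : ℕ) *
      monomialGL 1 x.2 := by
  rw [monomialGL_diag_pow, monomialGL_diag_pow, monomialGL_mul, monomialGL_mul, rootGL]
  congr 1
  funext i
  fin_cases i <;> simp

lemma exists_eq_finRotate_pow_mul_swap_pow (σ : Equiv.Perm (Fin 3)) :
    ∃ (m : Fin 3) (n : Fin 2), σ = finRotate 3 ^ (m : ℕ) * Equiv.swap 1 2 ^ (n : ℕ) := by
  revert σ
  decide

lemma monomialGL_perm_pow (σ : Equiv.Perm (Fin 3)) (n : ℕ) :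
    (monomialGL 1 σ : GL3 K) ^ n = monomialGL 1 (σ ^ n) := by
  induction n with
  | zero => rw [pow_zero, pow_zero, monomialGL_one]
  | succ n ih =>
    rw [pow_succ, ih, monomialGL_mul, pow_succ']
    congr 1
    simp [Pi.one_def]

lemma planeAut_fermatSextic_eq_closure [CharZero K] {u : Kˣ} (hu : IsPrimitiveRoot u 6) :
    planeAut (fermatSextic K) = Subgroup.closure
      {(QuotientGroup.mk (monomialGL ![u, 1, 1] 1) : PGL3 K),
        QuotientGroup.mk (monomialGL ![1, u, 1] 1),
        QuotientGroup.mk (monomialGL 1 (Equiv.swap 1 2)),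
        QuotientGroup.mk (monomialGL 1 (finRotate 3))} := by
  have hu6 : (u : K) ^ 6 = 1 := by rw [← Units.val_pow_eq_pow_val, hu.pow_eq_one, Units.val_one]
  apply le_antisymm
  · intro g hg
    rw [← SetLike.mem_coe, ← range_mk_rootGL hu] at hg
    obtain ⟨x, rfl⟩ := hg
    obtain ⟨m, n, hmn⟩ := exists_eq_finRotate_pow_mul_swap_pow x.2
    have hP : (monomialGL 1 x.2 : GL3 K)
        = monomialGL 1 (Equiv.swap 1 2) ^ (n : ℕ) * monomialGL 1 (finRotate 3) ^ (m : ℕ) := by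
      rw [hmn, monomialGL_perm_pow, monomialGL_perm_pow, monomialGL_mul]
      simp [Pi.one_def]
    simp only [rootGL_eq, hP, QuotientGroup.mk_mul, QuotientGroup.mk_pow]
    refine mul_mem (mul_mem (pow_mem ?_ _) (pow_mem ?_ _)) (mul_mem (pow_mem ?_ _) (pow_mem ?_ _))
      <;> exact Subgroup.subset_closure (by simp)
  · rw [Subgroup.closure_le]
    rintro g (rfl | rfl | rfl | rfl) <;> refine mk_monomialGL_mem_planeAut _ _ fun i => ?_ <;>
      fin_cases i <;> simp [hu6]

/-- The Fermat sextic is smooth, its automorphism group is generated by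
`diag(ζ₆,1,1)`, `diag(1,ζ₆,1)`, `[X:Z:Y]` and `[Y:Z:X]`, and has order `216`. -/
theorem fermat_sextic_automorphisms {K : Type*} [Field K] [IsAlgClosed K] [CharZero K]
    (ζ₆ : K) (hζ₆ : IsPrimitiveRoot ζ₆ 6) :
    IsSmoothSextic (fermatSextic K) ∧
    planeAut (fermatSextic K) = Subgroup.closure
      {pgl !![ζ₆, 0, 0; 0, 1, 0; 0, 0, 1], pgl !![1, 0, 0; 0, ζ₆, 0; 0, 0, 1],
        pgl !![(1 : K), 0, 0; 0, 0, 1; 0, 1, 0], pgl !![(0 : K), 1, 0; 0, 0, 1; 1, 0, 0]} ∧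
    Nat.card ↥(planeAut (fermatSextic K)) = 216 := by
  obtain ⟨u, rfl⟩ : ∃ u : Kˣ, (u : K) = ζ₆ := hζ₆.isUnit (by norm_num)
  have hu : IsPrimitiveRoot u 6 := IsPrimitiveRoot.coe_units_iff.mp hζ₆
  refine ⟨isSmoothSextic_fermatSextic, ?_, ?_⟩
  · have h1 : !![(u : K), 0, 0; 0, 1, 0; 0, 0, 1] = (monomialGL ![u, 1, 1] 1 : GL3 K) := by
      ext i j
      fin_cases i <;> fin_cases j <;> simp [monomialGL_apply]
    have h2 : !![1, 0, 0; 0, (u : K), 0; 0, 0, 1] = (monomialGL ![1, u, 1] 1 : GL3 K) := by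
      ext i j
      fin_cases i <;> fin_cases j <;> simp [monomialGL_apply]
    have h3 : !![(1 : K), 0, 0; 0, 0, 1; 0, 1, 0]
        = (monomialGL 1 (Equiv.swap 1 2) : GL3 K) := by
      ext i j
      fin_cases i <;> fin_cases j <;> simp [monomialGL_apply, Equiv.swap_apply_def]
    have h4 : !![(0 : K), 1, 0; 0, 0, 1; 1, 0, 0] = (monomialGL 1 (finRotate 3) : GL3 K) := by
      ext i j
      fin_cases i <;> fin_cases j <;> simp [monomialGL_apply]
    rw [h1, h2, h3, h4, pgl_coe, pgl_coe, pgl_coe, pgl_coe, planeAut_fermatSextic_eq_closure hu]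
  · rw [← SetLike.coe_sort_coe, ← range_mk_rootGL hu,
      Nat.card_range_of_injective (mk_rootGL_injective hu)]
    simp [Fintype.card_perm, Nat.factorial]
end
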